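/- arXiv:1809.10987 — 9 statements merged into one kernel-verified Lean document; each statement's English description precedes it below -/
import Mathlib

section
/- Let D ⊂ ℝ^n be a nonempty compact convex polyhedron (a bounded nonempty intersection of finitely many closed half-spaces), and let f : ℝ^n × ℝ^m → ℝ be the pointwise maximum of finitely many affine functions. Then the function g : ℝ^m → ℝ defined by g(y) = min_{x∈D} f(x,y) is well-defined (the minimum is attained) and is itself the pointwise maximum of finitely many affine functions on ℝ^m; in particular g is a convex piecewise-linear function with finitely many slopes. -/
noncomputable section

/-- Standard inner product on ℝ^n. -/
def dotp {n : ℕ} (a x : Fin n → ℝ) : ℝ := ∑ i, a i * x i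

/-- Λ is a (full-rank) lattice in ℝ^n. -/
def IsLattice {n : ℕ} (Λ : Set (Fin n → ℝ)) : Prop :=
  ∃ e : Module.Basis (Fin n) ℝ (Fin n → ℝ),
    Λ = {x | ∃ c : Fin n → ℤ, x = ∑ i, (c i : ℝ) • e i}

/-- Q is a symmetric bilinear form. -/
def IsSymmBilin {n : ℕ} (Q : (Fin n → ℝ) → (Fin n → ℝ) → ℝ) : Prop :=
  (∀ x, IsLinearMap ℝ (Q x)) ∧ ∀ x y, Q x y = Q y x

/-- Quasi-periodicity condition for (Q, α). -/
def QuasiPeriodic {n : ℕ} (Λ : Set (Fin n → ℝ))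
    (Q : (Fin n → ℝ) → (Fin n → ℝ) → ℝ) (α : (Fin n → ℝ) → ℝ)
    (Θ : (Fin n → ℝ) → ℝ) : Prop :=
  ∀ l ∈ Λ, ∀ x, Θ (x + l) = Θ x + Q l x + (1/2) * Q l l + α l

/-- Θ is regular: locally a max of finitely many affine functions with integral slopes. -/
def RegularFn {n : ℕ} (Θ : (Fin n → ℝ) → ℝ) : Prop :=
  ∀ x : Fin n → ℝ, ∃ U ∈ nhds x, ∃ (k : ℕ) (a : Fin (k+1) → Fin n → ℤ) (c : Fin (k+1) → ℝ),
    ∀ y ∈ U, Θ y = Finset.univ.sup' Finset.univ_nonempty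
      (fun i => dotp (fun j => (a i j : ℝ)) y + c i)

/-- A theta function for (Q, α): convex, regular, quasi-periodic. -/
def IsThetaFn {n : ℕ} (Λ : Set (Fin n → ℝ))
    (Q : (Fin n → ℝ) → (Fin n → ℝ) → ℝ) (α : (Fin n → ℝ) → ℝ)
    (Θ : (Fin n → ℝ) → ℝ) : Prop :=
  ConvexOn ℝ Set.univ Θ ∧ RegularFn Θ ∧ QuasiPeriodic Λ Q α Θ

/-- Q is integral with respect to Λ. -/
def IntegralWrt {n : ℕ} (Q : (Fin n → ℝ) → (Fin n → ℝ) → ℝ) (Λ : Set (Fin n → ℝ)) : Prop :=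
  ∀ l ∈ Λ, ∀ m : Fin n → ℤ, ∃ k : ℤ, Q l (fun i => (m i : ℝ)) = (k : ℝ)

/-- m lies in q(Λ): ⟨m,x⟩ = Q(λ,x) for some λ ∈ Λ and all x. -/
def InQLat {n : ℕ} (Λ : Set (Fin n → ℝ)) (Q : (Fin n → ℝ) → (Fin n → ℝ) → ℝ)
    (m : Fin n → ℝ) : Prop :=
  ∃ l ∈ Λ, ∀ x, dotp m x = Q l x

/-- The generator Θ_b (with v_b passed as `vb`). -/
def ThetaGen {n : ℕ} (Λ : Set (Fin n → ℝ)) (Q : (Fin n → ℝ) → (Fin n → ℝ) → ℝ)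
    (r vb : Fin n → ℝ) (b : Fin n → ℤ) (x : Fin n → ℝ) : ℝ :=
  sSup {t | ∃ l ∈ Λ, t = dotp (fun i => (b i : ℝ)) x + Q l x
      - (1/2) * Q (l + vb - r) (l + vb - r)}

/-- The Legendre transform of Θ. -/
def legendreT {n : ℕ} (Θ : (Fin n → ℝ) → ℝ) (a : Fin n → ℝ) : ℝ :=
  sSup {t | ∃ x, t = dotp a x - Θ x}

/-- The generator Θ_b, with v_b obtained from the duality map v. -/
def thetaGenOf {n : ℕ} (Λ : Set (Fin n → ℝ)) (Q : (Fin n → ℝ) → (Fin n → ℝ) → ℝ)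
    (r : Fin n → ℝ) (v : (Fin n → ℝ) → (Fin n → ℝ)) (b : Fin n → ℤ) :
    (Fin n → ℝ) → ℝ :=
  ThetaGen Λ Q r (v (fun i => (b i : ℝ))) b

/-- φ^b(Θ) = inf_y (Θ(y) − Θ_b(y)). -/
def phiB {n : ℕ} (Λ : Set (Fin n → ℝ)) (Q : (Fin n → ℝ) → (Fin n → ℝ) → ℝ)
    (r : Fin n → ℝ) (v : (Fin n → ℝ) → (Fin n → ℝ)) (b : Fin n → ℤ)
    (Θ : (Fin n → ℝ) → ℝ) : ℝ :=
  sInf {u | ∃ y, u = Θ y - thetaGenOf Λ Q r v b y}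

/-- The coordinate set S ⊂ ℝ^B of tuples (φ^b(Θ))_{b∈B} for theta functions Θ. -/
def thetaCoordSet {n : ℕ} (Λ : Set (Fin n → ℝ)) (Q : (Fin n → ℝ) → (Fin n → ℝ) → ℝ)
    (r : Fin n → ℝ) (v : (Fin n → ℝ) → (Fin n → ℝ)) (B : Finset (Fin n → ℤ)) :
    Set ({b // b ∈ B} → ℝ) :=
  {t | ∃ Θ, IsThetaFn Λ Q (fun x => Q x r) Θ ∧
      ∀ b : {b // b ∈ B}, t b = phiB Λ Q r v b.1 Θ}

/-- Ξ(x) = sup over a ∈ ℤ^n of (⟨a,x⟩ − ½ Q(v_a−r, v_a−r)). -/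
def XiFn {n : ℕ} (Q : (Fin n → ℝ) → (Fin n → ℝ) → ℝ) (v : (Fin n → ℝ) → (Fin n → ℝ))
    (r : Fin n → ℝ) (x : Fin n → ℝ) : ℝ :=
  sSup {t | ∃ a : Fin n → ℤ, t = dotp (fun i => (a i : ℝ)) x
      - (1/2) * Q (v (fun i => (a i : ℝ)) - r) (v (fun i => (a i : ℝ)) - r)}


/-- Finite intersections of closed affine half-spaces. -/
def IsPolyh {E : Type} [AddCommGroup E] [Module ℝ E] (S : Set E) : Prop :=
  ∃ F : Set (E →ᵃ[ℝ] ℝ), F.Finite ∧ S = {e | ∀ φ ∈ F, φ e ≤ 0}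

theorem exists_mid (A B : Set ℝ) (hA : A.Finite) (hB : B.Finite)
    (h : ∀ a ∈ A, ∀ b ∈ B, a ≤ b) : ∃ x, (∀ a ∈ A, a ≤ x) ∧ ∀ b ∈ B, x ≤ b := by
  rcases A.eq_empty_or_nonempty with rfl | hA'
  · obtain ⟨x, hx⟩ := hB.bddBelow
    exact ⟨x, by simp, fun b hb => hx hb⟩
  · exact ⟨sSup A, fun a ha => le_csSup hA.bddAbove ha,
      fun b hb => csSup_le hA' fun a ha => h a ha b hb⟩

theorem affine_split {E : Type} [AddCommGroup E] [Module ℝ E] (φ : E × ℝ →ᵃ[ℝ] ℝ) (e : E) (x : ℝ) :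
    φ (e, x) = φ (e, 0) + φ.linear (0, 1) * x := by
  have h := φ.map_vadd (e, 0) (x • ((0 : E), (1 : ℝ)))
  rw [map_smul] at h
  simp only [vadd_eq_add, smul_eq_mul, Prod.smul_mk, smul_zero, Prod.mk_add_mk, mul_one, zero_add,
    add_zero] at h
  rw [h]; ring

theorem IsPolyh.preimage {E E' : Type} [AddCommGroup E] [Module ℝ E] [AddCommGroup E'] [Module ℝ E']
    {S : Set E} (h : IsPolyh S) (g : E' →ᵃ[ℝ] E) : IsPolyh (g ⁻¹' S) := by
  obtain ⟨F, hF, rfl⟩ := h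
  refine ⟨(fun φ => φ.comp g) '' F, hF.image _, ?_⟩
  ext e
  simp

/-- One step of Fourier–Motzkin elimination. -/
theorem IsPolyh.fst_image {E : Type} [AddCommGroup E] [Module ℝ E] {S : Set (E × ℝ)}
    (h : IsPolyh S) : IsPolyh (Prod.fst '' S) := by
  obtain ⟨F, hF, rfl⟩ := h
  let j : E →ᵃ[ℝ] E × ℝ := (LinearMap.inl ℝ E ℝ).toAffineMap
  have hj : ∀ e, j e = (e, 0) := fun e => rfl
  let s : (E × ℝ →ᵃ[ℝ] ℝ) → ℝ := fun φ => φ.linear (0, 1)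
  refine ⟨(fun φ => φ.comp j) '' {φ ∈ F | s φ = 0} ∪
    Set.image2 (fun p q => s p • q.comp j - s q • p.comp j)
      {φ ∈ F | 0 < s φ} {φ ∈ F | s φ < 0}, ?_, ?_⟩
  · exact ((hF.subset (Set.sep_subset _ _)).image _).union
      ((hF.subset (Set.sep_subset _ _)).image2 _ (hF.subset (Set.sep_subset _ _)))
  ext e
  simp only [Set.mem_image, Set.mem_setOf_eq, Prod.exists, exists_and_right, exists_eq_right]
  constructor
  · rintro ⟨x, hx⟩ ψ (⟨φ, ⟨hφ, h0⟩, rfl⟩ | ⟨p, ⟨hp, hp0⟩, q, ⟨hq, hq0⟩, rfl⟩)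
    · have := hx φ hφ
      rw [affine_split] at this
      change φ.linear (0, 1) = 0 at h0
      rw [h0] at this
      simpa [hj] using this
    · have h1 := hx p hp
      have h2 := hx q hq
      rw [affine_split] at h1 h2
      change p (e, 0) + s p * x ≤ 0 at h1
      change q (e, 0) + s q * x ≤ 0 at h2
      change s p * q (e, 0) - s q * p (e, 0) ≤ 0
      nlinarith
  · intro H
    obtain ⟨x, hx1, hx2⟩ := exists_mid
      ((fun q => - q (e, 0) / s q) '' {φ ∈ F | s φ < 0})
      ((fun p => - p (e, 0) / s p) '' {φ ∈ F | 0 < s φ})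
      ((hF.subset (Set.sep_subset _ _)).image _) ((hF.subset (Set.sep_subset _ _)).image _) (by
        rintro _ ⟨q, ⟨hq, hq0⟩, rfl⟩ _ ⟨p, ⟨hp, hp0⟩, rfl⟩
        have := H _ (Or.inr ⟨p, ⟨hp, hp0⟩, q, ⟨hq, hq0⟩, rfl⟩)
        change s p * q (e, 0) - s q * p (e, 0) ≤ 0 at this
        change - q (e, 0) / s q ≤ - p (e, 0) / s p
        rw [le_div_iff₀ hp0, div_mul_eq_mul_div, div_le_iff_of_neg hq0]
        linarith)
    refine ⟨x, fun φ hφ => ?_⟩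
    rw [affine_split]
    change φ (e, 0) + s φ * x ≤ 0
    rcases lt_trichotomy (s φ) 0 with h0 | h0 | h0
    · have := hx1 _ ⟨φ, ⟨hφ, h0⟩, rfl⟩
      simp only at this
      rw [div_le_iff_of_neg h0] at this
      linarith
    · have := H _ (Or.inl ⟨φ, ⟨hφ, h0⟩, rfl⟩)
      change φ (e, 0) ≤ 0 at this
      rw [h0]; linarith
    · have := hx2 _ ⟨φ, ⟨hφ, h0⟩, rfl⟩
      simp only at this
      rw [le_div_iff₀ h0] at this
      linarith

/-- Projection along `ℝ^n`. -/
theorem IsPolyh.fst_image_pi (n : ℕ) : ∀ {E : Type} [AddCommGroup E] [Module ℝ E]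
    {S : Set (E × (Fin n → ℝ))}, IsPolyh S → IsPolyh (Prod.fst '' S) := by
  induction n with
  | zero =>
    intro E _ _ S h
    convert h.preimage (LinearMap.inl ℝ E (Fin 0 → ℝ)).toAffineMap using 1
    ext e
    constructor
    · rintro ⟨⟨e, v⟩, h, rfl⟩
      have : v = 0 := Subsingleton.elim _ _
      subst this
      exact h
    · intro h
      exact ⟨(e, 0), h, rfl⟩
  | succ n ih =>
    intro E _ _ S h
    let g : (E × ℝ) × (Fin n → ℝ) →ₗ[ℝ] E × (Fin (n+1) → ℝ) :=
      { toFun := fun p => (p.1.1, Fin.cons p.1.2 p.2)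
        map_add' := by
          intro p q
          refine Prod.ext rfl ?_
          funext i
          refine Fin.cases ?_ (fun i => ?_) i <;> simp
        map_smul' := by
          intro r p
          refine Prod.ext rfl ?_
          funext i
          refine Fin.cases ?_ (fun i => ?_) i <;> simp }
    have := (ih (h.preimage g.toAffineMap)).fst_image
    convert this using 1
    ext e
    constructor
    · rintro ⟨⟨e, v⟩, h, rfl⟩
      refine ⟨(e, v 0), ⟨((e, v 0), Fin.tail v), ?_, rfl⟩, rfl⟩
      change (e, Fin.cons (v 0) (Fin.tail v)) ∈ S
      rwa [Fin.cons_self_tail]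
    · rintro ⟨_, ⟨⟨⟨e, t⟩, v⟩, h, rfl⟩, rfl⟩
      exact ⟨_, h, rfl⟩

/-- `dotp` as a linear map. -/
def dotpL {n : ℕ} (a : Fin n → ℝ) : (Fin n → ℝ) →ₗ[ℝ] ℝ where
  toFun := dotp a
  map_add' x y := by simp [dotp, mul_add, Finset.sum_add_distrib]
  map_smul' r x := by
    simp only [dotp, Pi.smul_apply, smul_eq_mul, RingHom.id_apply, Finset.mul_sum]
    exact Finset.sum_congr rfl fun i _ => by ring

theorem affine_coord {m : ℕ} (ψ : (Fin m → ℝ) × ℝ →ᵃ[ℝ] ℝ) :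
    ∃ (α : Fin m → ℝ) (β γ : ℝ), ∀ y t, ψ (y, t) = dotp α y + β * t + γ := by
  refine ⟨fun i => ψ.linear (Pi.single i 1, 0), ψ.linear (0, 1), ψ (0, 0), fun y t => ?_⟩
  rw [affine_split]
  have h := ψ.map_vadd (0, 0) (y, 0)
  simp only [vadd_eq_add, Prod.mk_add_mk, add_zero] at h
  have h2 := LinearMap.pi_apply_eq_sum_univ (ψ.linear.comp (LinearMap.inl ℝ (Fin m → ℝ) ℝ)) y
  simp only [LinearMap.comp_apply, LinearMap.inl_apply, smul_eq_mul] at h2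
  have h3 : dotp (fun i => ψ.linear (Pi.single i 1, 0)) y = ψ.linear (y, 0) := by
    rw [h2, dotp]
    refine Finset.sum_congr rfl fun i _ => ?_
    rw [mul_comm]
    congr 3
    ext k
    simp [Pi.single_apply, eq_comm]
  rw [h, h3]; ring

theorem dotp_cont {n : ℕ} (a : Fin n → ℝ) : Continuous (dotp a) := by
  unfold dotp; fun_prop

theorem stmt0 (n m : ℕ) (D : Set (Fin n → ℝ))
    (hpoly : ∃ (N : ℕ) (a : Fin N → Fin n → ℝ) (c : Fin N → ℝ),
      D = {x | ∀ i, dotp (a i) x ≤ c i})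
    (hne : D.Nonempty) (hbdd : Bornology.IsBounded D)
    (f : (Fin n → ℝ) × (Fin m → ℝ) → ℝ)
    (hf : ∃ (k : ℕ) (a : Fin (k+1) → Fin n → ℝ) (b : Fin (k+1) → Fin m → ℝ)
        (c : Fin (k+1) → ℝ),
      ∀ p, f p = Finset.univ.sup' Finset.univ_nonempty
        (fun i => dotp (a i) p.1 + dotp (b i) p.2 + c i)) :
    (∀ y : Fin m → ℝ, ∃ x ∈ D, IsLeast {t | ∃ x' ∈ D, t = f (x', y)} (f (x, y))) ∧
    ∃ (k : ℕ) (a : Fin (k+1) → Fin m → ℝ) (c : Fin (k+1) → ℝ),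
      ∀ y : Fin m → ℝ, sInf {t | ∃ x ∈ D, t = f (x, y)} =
        Finset.univ.sup' Finset.univ_nonempty (fun i => dotp (a i) y + c i) := by
  obtain ⟨N, A, C, hD⟩ := hpoly
  obtain ⟨k, a, b, c, hf⟩ := hf
  have hfle : ∀ x y t, f (x, y) ≤ t ↔ ∀ i, dotp (a i) x + dotp (b i) y + c i ≤ t := by
    intro x y t
    rw [hf, Finset.sup'_le_iff]; simp
  have hclosed : IsClosed D := by
    rw [hD, Set.setOf_forall]
    exact isClosed_iInter fun i => isClosed_le (dotp_cont _) continuous_const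
  have hcomp : IsCompact D := Metric.isCompact_of_isClosed_isBounded hclosed hbdd
  have hmin : ∀ y : Fin m → ℝ, ∃ x ∈ D, IsLeast {t | ∃ x' ∈ D, t = f (x', y)} (f (x, y)) := by
    intro y
    have hc : Continuous fun x => f (x, y) := by
      simp only [hf]
      exact Continuous.finset_sup'_apply _ fun i _ =>
        ((dotp_cont _).add continuous_const).add continuous_const
    obtain ⟨x, hx, hm⟩ := hcomp.exists_isMinOn hne hc.continuousOn
    refine ⟨x, hx, ⟨x, hx, rfl⟩, ?_⟩
    rintro _ ⟨x', hx', rfl⟩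
    exact hm hx'
  refine ⟨hmin, ?_⟩
  choose X hXD hX using hmin
  -- the epigraph is polyhedral
  let pr := ((Fin m → ℝ) × ℝ) × (Fin n → ℝ)
  let Lx : pr →ₗ[ℝ] (Fin n → ℝ) := LinearMap.snd ℝ _ _
  let Ly : pr →ₗ[ℝ] (Fin m → ℝ) := LinearMap.fst ℝ _ _ ∘ₗ LinearMap.fst ℝ _ _
  let Lt : pr →ₗ[ℝ] ℝ := LinearMap.snd ℝ _ _ ∘ₗ LinearMap.fst ℝ _ _
  let F1 : Fin N → (pr →ᵃ[ℝ] ℝ) := fun i =>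
    (dotpL (A i) ∘ₗ Lx).toAffineMap + AffineMap.const ℝ pr (-C i)
  let F2 : Fin (k+1) → (pr →ᵃ[ℝ] ℝ) := fun i =>
    (dotpL (a i) ∘ₗ Lx + dotpL (b i) ∘ₗ Ly - Lt).toAffineMap + AffineMap.const ℝ pr (c i)
  have hF1 : ∀ i y t x, F1 i ((y, t), x) = dotp (A i) x + -C i := fun _ _ _ _ => rfl
  have hF2 : ∀ i y t x, F2 i ((y, t), x) = dotp (a i) x + dotp (b i) y - t + c i :=
    fun _ _ _ _ => rfl
  have hP : IsPolyh {p : pr | ∀ φ ∈ Set.range F1 ∪ Set.range F2, φ p ≤ 0} :=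
    ⟨_, (Set.finite_range _).union (Set.finite_range _), rfl⟩
  obtain ⟨F, hFfin, hF⟩ := IsPolyh.fst_image_pi n hP
  have key : ∀ y t, f (X y, y) ≤ t ↔ ∀ ψ ∈ F, ψ (y, t) ≤ 0 := by
    intro y t
    have h1 : (∀ ψ ∈ F, ψ (y, t) ≤ 0) ↔ ∃ x ∈ D, f (x, y) ≤ t := by
      change (y, t) ∈ {e | ∀ ψ ∈ F, ψ e ≤ 0} ↔ _
      rw [← hF]
      have h2 : ∀ x, ((y, t), x) ∈ {p : pr | ∀ φ ∈ Set.range F1 ∪ Set.range F2, φ p ≤ 0} ↔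
          x ∈ D ∧ f (x, y) ≤ t := by
        intro x
        rw [hfle, hD]
        constructor
        · intro h
          refine ⟨fun i => ?_, fun i => ?_⟩
          · have := h _ (Or.inl ⟨i, rfl⟩)
            rw [hF1] at this; linarith
          · have := h _ (Or.inr ⟨i, rfl⟩)
            rw [hF2] at this; linarith
        · rintro ⟨h1, h2⟩ _ (⟨i, rfl⟩ | ⟨i, rfl⟩)
          · rw [hF1]; have := h1 i; linarith
          · rw [hF2]; have := h2 i; linarith
      constructor
      · rintro ⟨⟨_, x⟩, h, rfl⟩
        exact ⟨x, (h2 x).1 h⟩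
      · rintro ⟨x, h⟩
        exact ⟨_, (h2 x).2 h, rfl⟩
    rw [h1]
    exact ⟨fun h => ⟨_, hXD y, h⟩, fun ⟨x, hx, h⟩ => ((hX y).2 ⟨x, hx, rfl⟩).trans h⟩
  choose α β γ hαβ using fun ψ : (Fin m → ℝ) × ℝ →ᵃ[ℝ] ℝ => affine_coord ψ
  simp only [hαβ] at key
  have hβ : ∀ ψ ∈ F, β ψ ≤ 0 := by
    intro ψ hψ
    by_contra! hpos
    have h1 := (key 0 (max (f (X 0, 0)) ((1 - dotp (α ψ) 0 - γ ψ) / β ψ))).1 (le_max_left _ _) ψ hψ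
    have h2 := le_max_right (f (X 0, 0)) ((1 - dotp (α ψ) 0 - γ ψ) / β ψ)
    rw [div_le_iff₀ hpos] at h2
    linarith
  let G := {ψ ∈ F | β ψ < 0}
  have hGfin : G.Finite := hFfin.subset (Set.sep_subset _ _)
  have hGne : G.Nonempty := by
    by_contra! hG
    have : f (X 0, 0) ≤ f (X 0, 0) - 1 := by
      rw [key]
      intro ψ hψ
      have h0 : β ψ = 0 := by
        rcases (hβ ψ hψ).lt_or_eq with h | h
        · exact absurd (show ψ ∈ G from ⟨hψ, h⟩) (by simp [hG])
        · exact h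
      have := (key 0 _).1 le_rfl ψ hψ
      rw [h0] at this ⊢
      linarith
    linarith
  obtain ⟨K, e, he⟩ : ∃ (K : ℕ) (e : Fin (K+1) → ((Fin m → ℝ) × ℝ →ᵃ[ℝ] ℝ)), Set.range e = G := by
    have : Nonempty G := hGne.to_subtype
    have : Finite G := hGfin
    obtain ⟨K, ⟨eq⟩⟩ := Finite.exists_equiv_fin G
    cases K with
    | zero => exact (eq (Classical.arbitrary G)).elim0
    | succ K =>
      refine ⟨K, fun i => (eq.symm i : _), ?_⟩
      ext ψ
      constructor
      · rintro ⟨i, rfl⟩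
        exact (eq.symm i).2
      · intro h
        exact ⟨eq ⟨ψ, h⟩, by simp⟩
  have heG : ∀ i, e i ∈ G := fun i => he ▸ ⟨i, rfl⟩
  refine ⟨K, fun i j => (-β (e i))⁻¹ * α (e i) j, fun i => (-β (e i))⁻¹ * γ (e i), fun y => ?_⟩
  rw [(hX y).csInf_eq]
  have hval : ∀ i, dotp (fun j => (-β (e i))⁻¹ * α (e i) j) y + (-β (e i))⁻¹ * γ (e i)
      = (dotp (α (e i)) y + γ (e i)) / (-β (e i)) := by
    intro i
    have : dotp (fun j => (-β (e i))⁻¹ * α (e i) j) y = (-β (e i))⁻¹ * dotp (α (e i)) y := by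
      simp only [dotp, Finset.mul_sum, mul_assoc]
    rw [this, div_eq_inv_mul]; ring
  simp only [hval]
  apply le_antisymm
  · rw [key]
    intro ψ hψ
    rcases (hβ ψ hψ).lt_or_eq with h | h
    · obtain ⟨i, rfl⟩ : ψ ∈ Set.range e := he ▸ ⟨hψ, h⟩
      have := Finset.le_sup' (fun i => (dotp (α (e i)) y + γ (e i)) / (-β (e i)))
        (Finset.mem_univ i)
      rw [div_le_iff₀ (by linarith)] at this
      linarith
    · have := (key y _).1 le_rfl ψ hψ
      rw [h] at this ⊢
      linarith
  · refine Finset.sup'_le _ _ fun i _ => ?_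
    have := (key y _).1 le_rfl (e i) (heG i).1
    have h := (heG i).2
    rw [div_le_iff₀ (by linarith)]
    linarith
end
end

section
/- Let Λ be a lattice in ℝ^n, let Q be a symmetric bilinear form on ℝ^n, and let α : ℝ^n → ℝ be linear. If there exists λ₀ ∈ Λ with Q(λ₀,λ₀) < 0, then there is no convex function Θ : ℝ^n → ℝ satisfying the quasi-periodicity condition for (Q, α). -/
noncomputable section

theorem stmt1 {n : ℕ} (Λ : Set (Fin n → ℝ)) (hΛ : IsLattice Λ)
    (Q : (Fin n → ℝ) → (Fin n → ℝ) → ℝ) (hQ : IsSymmBilin Q)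
    (α : (Fin n → ℝ) → ℝ) (hα : IsLinearMap ℝ α)
    (l0 : Fin n → ℝ) (hl0 : l0 ∈ Λ) (hneg : Q l0 l0 < 0) :
    ¬ ∃ Θ : (Fin n → ℝ) → ℝ, ConvexOn ℝ Set.univ Θ ∧ QuasiPeriodic Λ Q α Θ := by
  rintro ⟨Θ, hc, hq⟩
  have h1 := hq l0 hl0 0
  have h2 := hq l0 hl0 l0
  have h0 : Q l0 0 = 0 := (hQ.1 l0).map_zero
  have h3 := hc.2 (Set.mem_univ (0 : Fin n → ℝ)) (Set.mem_univ (l0 + l0))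
    (by norm_num : (0 : ℝ) ≤ 1 / 2) (by norm_num : (0 : ℝ) ≤ 1 / 2) (by norm_num)
  have h4 : (1 / 2 : ℝ) • (0 : Fin n → ℝ) + (1 / 2 : ℝ) • (l0 + l0) = l0 := by
    ext i
    simp only [Pi.add_apply, Pi.smul_apply, Pi.zero_apply, smul_eq_mul]
    ring
  rw [h4] at h3
  rw [zero_add, h0] at h1
  simp only [smul_eq_mul] at h3
  linarith
end
end

section
/- Let f : ℝ^n → ℝ be a convex function and let L ⊂ ℝ^n be an additive subgroup such that f(x+λ) = f(x) for all λ ∈ L and x ∈ ℝ^n. Then f(x+v) = f(x) for every v in the ℝ-linear span of L and every x ∈ ℝ^n; that is, a convex function periodic with respect to L is constant along the subspace spanned by L. -/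
noncomputable section

theorem stmt2 {n : ℕ} (f : (Fin n → ℝ) → ℝ) (hf : ConvexOn ℝ Set.univ f)
    (L : AddSubgroup (Fin n → ℝ))
    (hper : ∀ l ∈ L, ∀ x, f (x + l) = f x) :
    ∀ v ∈ Submodule.span ℝ (L : Set (Fin n → ℝ)), ∀ x, f (x + v) = f x := by
  have hle : ∀ l ∈ L, ∀ (t : ℝ) (x : Fin n → ℝ), f (x + t • l) ≤ f x := by
    intro l hl t x
    have h1 : f (x + ⌊t⌋ • l) = f x := hper _ (L.zsmul_mem hl _) x
    have h2 : f (x + (⌊t⌋ + 1) • l) = f x := hper _ (L.zsmul_mem hl _) x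
    have hc := hf.2 (Set.mem_univ (x + ⌊t⌋ • l)) (Set.mem_univ (x + (⌊t⌋ + 1) • l))
      (sub_nonneg.2 (Int.fract_lt_one t).le) (Int.fract_nonneg t) (by ring)
    have he : (1 - Int.fract t) • (x + ⌊t⌋ • l) + Int.fract t • (x + (⌊t⌋ + 1) • l)
        = x + t • l := by
      ext i
      have := Int.floor_add_fract t
      simp only [Pi.add_apply, Pi.smul_apply]
      simp only [smul_eq_mul, zsmul_eq_mul]
      push_cast
      linear_combination (l i) * this
    rw [he, h1, h2] at hc
    simp only [smul_eq_mul] at hc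
    linarith
  have key : ∀ v ∈ Submodule.span ℝ (L : Set (Fin n → ℝ)), ∀ (t : ℝ) (x : Fin n → ℝ),
      f (x + t • v) = f x := by
    intro v hv
    induction hv using Submodule.span_induction with
    | mem l hl =>
      intro t x
      refine le_antisymm (hle l hl t x) ?_
      have := hle l hl (-t) (x + t • l)
      simpa using this
    | zero => intro t x; simp
    | add u w _ _ hu hw =>
      intro t x
      rw [smul_add, ← add_assoc, hw, hu]
    | smul a u _ hu =>
      intro t x
      rw [smul_smul, hu]
  intro v hv x
  simpa using key v hv 1 x
end
end

section
/- Let Λ be a lattice in ℝ^n, let Q be a positive definite symmetric bilinear form on ℝ^n that is integral with respect to Λ, fix r ∈ ℝ^n, and let Θ : ℝ^n → ℝ be a convex function satisfying the quasi-periodicity condition for (Q, Q(·,r)). Then for every a ∈ ℝ^n the supremum Θ̂(a) = sup_{x∈ℝ^n}(⟨a,x⟩ − Θ(x)) is finite and attained, and for every a ∈ ℝ^n and λ ∈ Λ one has Θ̂(a − q(λ)) = Θ̂(a) − ⟨a,λ⟩ + (1/2)Q(λ,λ) + Q(λ,r), where q(λ) ∈ ℝ^n denotes the unique vector with ⟨q(λ),x⟩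 = Q(λ,x) for all x. -/
noncomputable section

theorem aux_cont_lin {n : ℕ} {f : (Fin n → ℝ) → ℝ} (h : IsLinearMap ℝ f) : Continuous f :=
  (h.mk' f).continuous_of_finiteDimensional

theorem aux_coercive {n : ℕ} {q : (Fin n → ℝ) → ℝ} (hc : Continuous q)
    (hsm : ∀ (t : ℝ) x, q (t • x) = t ^ 2 * q x) (hpos : ∀ x, x ≠ 0 → 0 < q x) :
    ∃ c > 0, ∀ x, c * ‖x‖ ^ 2 ≤ q x := by
  have h0 : q 0 = 0 := by simpa using hsm 0 0
  have key : ∀ x : Fin n → ℝ, x ≠ 0 → q x = ‖x‖ ^ 2 * q (‖x‖⁻¹ • x) ∧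
      ‖x‖⁻¹ • x ∈ Metric.sphere (0 : Fin n → ℝ) 1 := by
    intro x hx
    have hn : ‖x‖ ≠ 0 := norm_ne_zero_iff.mpr hx
    constructor
    · rw [← hsm, smul_smul, mul_inv_cancel₀ hn, one_smul]
    · simp [norm_smul, hn]
  by_cases hne : (Metric.sphere (0 : Fin n → ℝ) 1).Nonempty
  · obtain ⟨u, hu, hmin⟩ := (isCompact_sphere (0 : Fin n → ℝ) 1).exists_isMinOn hne hc.continuousOn
    have hu0 : u ≠ 0 := by
      rintro rfl
      simp at hu
    refine ⟨q u, hpos u hu0, fun x => ?_⟩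
    by_cases hx : x = 0
    · subst hx; simp [h0]
    · obtain ⟨h1, h2⟩ := key x hx
      rw [h1, mul_comm]
      exact mul_le_mul_of_nonneg_left (hmin h2) (by positivity)
  · refine ⟨1, one_pos, fun x => ?_⟩
    by_cases hx : x = 0
    · subst hx; simp [h0]
    · exact absurd ⟨_, (key x hx).2⟩ hne

theorem aux_periodic_bdd {n : ℕ} {Λ : Set (Fin n → ℝ)} (hΛ : IsLattice Λ)
    {P : (Fin n → ℝ) → ℝ} (hP : Continuous P) (hper : ∀ l ∈ Λ, ∀ x, P (x + l) = P x) :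
    ∃ C, ∀ x, C ≤ P x := by
  obtain ⟨e, rfl⟩ := hΛ
  have hK : IsCompact ((fun t : Fin n → ℝ => ∑ i, t i • e i) '' Set.Icc 0 1) :=
    isCompact_Icc.image (by fun_prop)
  obtain ⟨C, hC⟩ := (hK.image hP).bddBelow
  refine ⟨C, fun x => ?_⟩
  have hx : x = (∑ i, Int.fract (e.repr x i) • e i) + ∑ i, ((⌊e.repr x i⌋ : ℤ) : ℝ) • e i := by
    rw [← Finset.sum_add_distrib]
    conv_lhs => rw [← e.sum_repr x]
    refine Finset.sum_congr rfl fun i _ => ?_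
    rw [← add_smul, Int.fract_add_floor]
  rw [hx, hper _ ⟨fun i => ⌊e.repr x i⌋, rfl⟩]
  exact hC ⟨_, ⟨fun i => Int.fract (e.repr x i), ⟨fun i => Int.fract_nonneg _,
    fun i => (Int.fract_lt_one _).le⟩, rfl⟩, rfl⟩

theorem stmt3 {n : ℕ} (Λ : Set (Fin n → ℝ)) (hΛ : IsLattice Λ)
    (Q : (Fin n → ℝ) → (Fin n → ℝ) → ℝ) (hQ : IsSymmBilin Q)
    (hpos : ∀ x : Fin n → ℝ, x ≠ 0 → 0 < Q x x) (hint : IntegralWrt Q Λ)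
    (r : Fin n → ℝ) (Θ : (Fin n → ℝ) → ℝ) (hconv : ConvexOn ℝ Set.univ Θ)
    (hqp : QuasiPeriodic Λ Q (fun x => Q x r) Θ)
    (qm : (Fin n → ℝ) → (Fin n → ℝ)) (hqm : ∀ l x, dotp (qm l) x = Q l x) :
    (∀ a : Fin n → ℝ, ∃ x0 : Fin n → ℝ,
      IsGreatest {t | ∃ x, t = dotp a x - Θ x} (dotp a x0 - Θ x0)) ∧
    (∀ a : Fin n → ℝ, ∀ l ∈ Λ,
      legendreT Θ (a - qm l) = legendreT Θ a - dotp a l + (1/2) * Q l l + Q l r) := by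
  have hlin := hQ.1
  have hsym := hQ.2
  have addr : ∀ x y z, Q x (y + z) = Q x y + Q x z := fun x y z => (hlin x).map_add y z
  have addl : ∀ x y z, Q (x + y) z = Q x z + Q y z := fun x y z => by
    rw [hsym, addr, hsym z x, hsym z y]
  have smulr : ∀ (t : ℝ) x y, Q x (t • y) = t * Q x y := fun t x y => (hlin x).map_smul t y
  have smull : ∀ (t : ℝ) x y, Q (t • x) y = t * Q x y := fun t x y => by
    rw [hsym, smulr, hsym]
  have dadd : ∀ a x y : Fin n → ℝ, dotp a (x + y) = dotp a x + dotp a y := fun a x y => by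
    simp [dotp, mul_add, Finset.sum_add_distrib]
  have dsub : ∀ a b x : Fin n → ℝ, dotp (a - b) x = dotp a x - dotp b x := fun a b x => by
    simp [dotp, sub_mul, Finset.sum_sub_distrib]
  have dlin : ∀ a : Fin n → ℝ, IsLinearMap ℝ (dotp a) := fun a =>
    ⟨dadd a, fun t x => by simp [dotp, Finset.mul_sum, mul_left_comm]⟩
  have hqmi : ∀ x i, qm x i = Q (Pi.single i 1) x := fun x i => by
    rw [hsym, ← hqm]; simp [dotp, Pi.single_apply]
  have hQc : Continuous fun x => Q x x := by
    have : (fun x => Q x x) = fun x => ∑ i, Q (Pi.single i 1) x * x i := by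
      funext x
      rw [← hqm]
      simp only [dotp, hqmi]
    rw [this]
    exact continuous_finset_sum _ fun i _ =>
      (aux_cont_lin (hlin _)).mul (continuous_apply i)
  have hQr : Continuous fun x => Q x r := by
    simp_rw [fun x => hsym x r]
    exact aux_cont_lin (hlin r)
  have hΘ : Continuous Θ := by
    rw [← continuousOn_univ]
    exact hconv.continuousOn isOpen_univ
  obtain ⟨c, hc, hcQ⟩ := aux_coercive hQc
    (fun t x => by rw [smull, smulr]; ring) hpos
  obtain ⟨C, hC⟩ := aux_periodic_bdd hΛ (P := fun x => Θ x - (1/2) * Q x x - Q x r)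
    ((hΘ.sub (hQc.const_mul _)).sub hQr) (by
      intro l hl x
      have := hqp l hl x
      simp only [addl, addr] at this ⊢
      rw [this, hsym x l]; ring)
  have hatt : ∀ a : Fin n → ℝ, ∃ x0 : Fin n → ℝ,
      IsGreatest {t | ∃ x, t = dotp a x - Θ x} (dotp a x0 - Θ x0) := by
    intro a
    have hL : IsLinearMap ℝ fun x => Q r x - dotp a x :=
      ⟨fun x y => by rw [addr, dadd]; ring,
       fun t x => by rw [smulr, (dlin a).map_smul]; simp only [smul_eq_mul]; ring⟩
    let L : (Fin n → ℝ) →L[ℝ] ℝ := (hL.mk' _).toContinuousLinearMap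
    have hLx : ∀ x, L x = Q r x - dotp a x := fun x => rfl
    have hcont : Continuous fun x => Θ x - dotp a x := hΘ.sub (aux_cont_lin (dlin a))
    have hlow : ∀ x, ‖x‖ * (c / 2 * ‖x‖ - ‖L‖) + C ≤ Θ x - dotp a x := by
      intro x
      have h1 := hC x
      have h2 := hcQ x
      have h3 := (abs_le.mp (Real.norm_eq_abs (L x) ▸ L.le_opNorm x)).1
      rw [hLx] at h3
      simp only [hsym x r] at h1
      nlinarith
    have htend : Filter.Tendsto (fun x => Θ x - dotp a x)
        (Filter.cocompact (Fin n → ℝ)) Filter.atTop := by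
      refine Filter.tendsto_atTop_mono hlow ?_
      have h1 : Filter.Tendsto (fun s : ℝ => s * (c / 2 * s - ‖L‖) + C)
          Filter.atTop Filter.atTop := by
        refine Filter.tendsto_atTop_add_const_right _ _ (Filter.tendsto_id.atTop_mul_atTop₀ ?_)
        exact Filter.tendsto_atTop_add_const_right _ (-‖L‖)
          (Filter.tendsto_id.const_mul_atTop (half_pos hc))
      exact h1.comp (tendsto_norm_cocompact_atTop (E := Fin n → ℝ))
    obtain ⟨x0, hx0⟩ := hcont.exists_forall_le htend
    refine ⟨x0, ⟨x0, rfl⟩, ?_⟩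
    rintro t ⟨x, rfl⟩
    have := hx0 x
    linarith
  refine ⟨hatt, fun a l hl => ?_⟩
  obtain ⟨x0, hx0⟩ := hatt a
  have hg : IsGreatest {t | ∃ x, t = dotp (a - qm l) x - Θ x}
      (dotp a x0 - Θ x0 - dotp a l + (1/2) * Q l l + Q l r) := by
    constructor
    · refine ⟨x0 - l, ?_⟩
      have h := hqp l hl (x0 - l)
      have h' := dadd a (x0 - l) l
      rw [sub_add_cancel] at h h'
      rw [dsub, hqm]
      linarith
    · rintro t ⟨x, rfl⟩
      have h := hqp l hl x
      have h2 := hx0.2 ⟨x + l, rfl⟩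
      rw [dadd] at h2
      rw [dsub, hqm]
      linarith
  unfold legendreT
  rw [hg.csSup_eq, hx0.csSup_eq]
end
end

section
/- Let Λ be a lattice in ℝ^n, let Q be a positive definite symmetric bilinear form on ℝ^n that is integral with respect to Λ, fix r ∈ ℝ^n, and let B ⊂ ℤ^n be a complete set of representatives of the quotient group ℤ^n/q(Λ), with at least two elements. Then for every b ∈ B, the generator Θ_b cannot be expressed as a tropical combination of the other generators: there is no family (s_{b'})_{b'∈B∖{b}} with values in ℝ ∪ {−∞}, not all −∞, such that Θ_b(x) = sup_{b'∈B, b'≠b}(Θ_{b'}(x) + s_{b'}) for all x ∈ ℝ^n. -/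
noncomputable section

lemma T_eq {n : ℕ} (Q : (Fin n → ℝ) → (Fin n → ℝ) → ℝ)
    (hadd : ∀ x y z, Q x (y + z) = Q x y + Q x z)
    (hsub : ∀ x y z, Q x (y - z) = Q x y - Q x z)
    (hsym : ∀ x y, Q x y = Q y x) (l a r x : Fin n → ℝ) :
    Q a x + Q l x - (1/2) * Q (l + a - r) (l + a - r) =
      Q r x + (1/2) * Q x x - (1/2) * Q (l + a - r - x) (l + a - r - x) := by
  have hadd' : ∀ x y z, Q (y + z) x = Q y x + Q z x := fun x y z => by
    rw [hsym, hadd, hsym x y, hsym x z]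
  have hsub' : ∀ x y z, Q (y - z) x = Q y x - Q z x := fun x y z => by
    rw [hsym, hsub, hsym x y, hsym x z]
  simp only [hadd, hsub, hadd', hsub']
  rw [hsym x l, hsym x a, hsym x r]
  ring

theorem stmt7 {n : ℕ} (Λ : Set (Fin n → ℝ)) (hΛ : IsLattice Λ)
    (Q : (Fin n → ℝ) → (Fin n → ℝ) → ℝ) (hQ : IsSymmBilin Q)
    (hpos : ∀ x : Fin n → ℝ, x ≠ 0 → 0 < Q x x) (hint : IntegralWrt Q Λ)
    (r : Fin n → ℝ) (v : (Fin n → ℝ) → (Fin n → ℝ))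
    (hv : ∀ a x, Q (v a) x = dotp a x)
    (B : Finset (Fin n → ℤ))
    (hB : ∀ m : Fin n → ℤ, ∃! b, b ∈ B ∧
      InQLat Λ Q (fun i => (m i : ℝ) - (b i : ℝ)))
    (hcard : 2 ≤ B.card) (b : Fin n → ℤ) (hb : b ∈ B) :
    ¬ ∃ s : (Fin n → ℤ) → WithBot ℝ,
        (∃ b' ∈ B.erase b, s b' ≠ ⊥) ∧
        ∀ x : Fin n → ℝ, (thetaGenOf Λ Q r v b x : WithBot ℝ) =
          (B.erase b).sup (fun b' => (thetaGenOf Λ Q r v b' x : WithBot ℝ) + s b') := by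
  classical
  rintro ⟨s, ⟨b1, hb1, -⟩, hs⟩
  have hsym := hQ.2
  have hadd : ∀ x y z, Q x (y + z) = Q x y + Q x z := fun x y z => (hQ.1 x).map_add y z
  have hsub : ∀ x y z, Q x (y - z) = Q x y - Q x z := fun x y z => (hQ.1 x).map_sub y z
  have hsmul : ∀ x (c : ℝ) y, Q x (c • y) = c * Q x y := fun x c y => (hQ.1 x).map_smul c y
  have hadd' : ∀ x y z, Q (y + z) x = Q y x + Q z x := fun x y z => by
    rw [hsym, hadd, hsym x y, hsym x z]
  have hsub' : ∀ x y z, Q (y - z) x = Q y x - Q z x := fun x y z => by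
    rw [hsym, hsub, hsym x y, hsym x z]
  have hsmul' : ∀ x (c : ℝ) y, Q (c • y) x = c * Q y x := fun x c y => by
    rw [hsym, hsmul, hsym x y]
  have hnn : ∀ x, 0 ≤ Q x x := fun x => by
    by_cases hx : x = 0
    · have := hsmul x 0 x
      rw [zero_smul, zero_mul] at this
      rw [hx] at this ⊢
      exact this.ge
    · exact (hpos x hx).le
  have hCS : ∀ x y, Q x y ^ 2 ≤ Q x x * Q y y := fun x y => by
    by_cases hx : x = 0
    · have h0 : ∀ z, Q x z = 0 := fun z => by
        have := hsmul' z 0 x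
        rw [zero_smul, zero_mul] at this
        rw [hx]; exact this
      rw [h0, h0]; simp
    · have hp := hpos x hx
      have h := hnn (Q x x • y - Q x y • x)
      simp only [hsub, hsub', hsmul, hsmul'] at h
      rw [hsym y x] at h
      have h2 : 0 ≤ Q x x * (Q x x * Q y y - Q x y ^ 2) := by nlinarith
      have := nonneg_of_mul_nonneg_right h2 hp
      linarith
  have h0Λ : (0 : Fin n → ℝ) ∈ Λ := by
    obtain ⟨e, rfl⟩ := hΛ
    exact ⟨0, by simp⟩
  have hsubΛ : ∀ x ∈ Λ, ∀ y ∈ Λ, x - y ∈ Λ := by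
    obtain ⟨e, rfl⟩ := hΛ
    rintro x ⟨c, rfl⟩ y ⟨c', rfl⟩
    exact ⟨c - c', by simp [sub_smul, Finset.sum_sub_distrib]⟩
  -- discreteness
  obtain ⟨δ, hδ, hdisc⟩ : ∃ δ > 0, ∀ l ∈ Λ, l ≠ 0 → δ ≤ Q l l := by
    have hM : 0 ≤ ∑ i : Fin n, Q (Pi.single i 1) (Pi.single i 1) :=
      Finset.sum_nonneg fun i _ => hnn _
    refine ⟨1 / (1 + ∑ i : Fin n, Q (Pi.single i 1) (Pi.single i 1)), by positivity, ?_⟩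
    intro l hl hl0
    have : ∃ i : Fin n, Q l (Pi.single i 1) ≠ 0 := by
      by_contra! hc
      have hz : IsLinearMap.mk' (Q l) (hQ.1 l) = 0 := by
        apply LinearMap.pi_ext'
        intro i
        ext
        simpa using hc i
      have : Q l l = 0 := by
        have := LinearMap.congr_fun hz l
        simpa using this
      exact (hpos l hl0).ne' this
    obtain ⟨i, hi⟩ := this
    obtain ⟨k, hk⟩ := hint l hl (Pi.single i 1)
    have he : (fun j => ((Pi.single i 1 : Fin n → ℤ) j : ℝ)) = Pi.single i 1 := by
      ext j
      by_cases hj : j = i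
      · subst hj; simp
      · simp [hj]
    rw [he] at hk
    have hk0 : k ≠ 0 := by
      rintro rfl
      exact hi (by simpa using hk)
    have h1 : (1 : ℝ) ≤ Q l (Pi.single i 1) ^ 2 := by
      rw [hk]
      have : 0 < k ^ 2 := by positivity
      exact_mod_cast this
    have h2 := hCS l (Pi.single i 1)
    have h3 : Q (Pi.single i 1) (Pi.single i 1) ≤
        ∑ i : Fin n, Q (Pi.single i 1) (Pi.single i 1) :=
      Finset.single_le_sum (f := fun i : Fin n => Q (Pi.single i 1) (Pi.single i 1))
        (fun i _ => hnn _) (Finset.mem_univ i)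
    rw [div_le_iff₀ (by positivity)]
    nlinarith [hnn l]
  -- generator facts
  set w : (Fin n → ℤ) → (Fin n → ℝ) := fun c => v (fun i => (c i : ℝ)) with hw
  have hset : ∀ c x, thetaGenOf Λ Q r v c x = sSup {t | ∃ l ∈ Λ, t = Q r x + (1/2) * Q x x
      - (1/2) * Q (l + w c - r - x) (l + w c - r - x)} := by
    intro c x
    unfold thetaGenOf ThetaGen
    congr 1
    ext t
    simp only [Set.mem_setOf_eq]
    refine exists_congr fun l => and_congr_right fun _ => ?_
    rw [← T_eq Q hadd hsub hsym, ← hv]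
  have hbdd : ∀ c x, BddAbove {t | ∃ l ∈ Λ, t = Q r x + (1/2) * Q x x
      - (1/2) * Q (l + w c - r - x) (l + w c - r - x)} := by
    intro c x
    refine ⟨Q r x + (1/2) * Q x x, ?_⟩
    rintro t ⟨l, -, rfl⟩
    linarith [hnn (l + w c - r - x)]
  have hge : ∀ c x, ∀ l ∈ Λ, Q r x + (1/2) * Q x x
      - (1/2) * Q (l + w c - r - x) (l + w c - r - x) ≤ thetaGenOf Λ Q r v c x := by
    intro c x l hl
    rw [hset]
    exact le_csSup (hbdd c x) ⟨l, hl, rfl⟩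
  set x0 := w b - r with hx0
  obtain ⟨b', hb', hEq⟩ := Finset.exists_mem_eq_sup (B.erase b) ⟨b1, hb1⟩
    (fun b' => (thetaGenOf Λ Q r v b' x0 : WithBot ℝ) + s b')
  rw [← hs x0] at hEq
  obtain ⟨σ, hσ⟩ : ∃ σ : ℝ, s b' = (σ : WithBot ℝ) := by
    cases h : s b' with
    | bot => rw [h] at hEq; simp at hEq
    | coe a => exact ⟨a, rfl⟩
  rw [hσ] at hEq
  have hEq' : thetaGenOf Λ Q r v b x0 = thetaGenOf Λ Q r v b' x0 + σ := by exact_mod_cast hEq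
  have hLe : ∀ x, thetaGenOf Λ Q r v b' x + σ ≤ thetaGenOf Λ Q r v b x := by
    intro x
    have h := Finset.le_sup (f := fun b' => (thetaGenOf Λ Q r v b' x : WithBot ℝ) + s b') hb'
    rw [← hs x] at h
    simp only [hσ] at h
    exact_mod_cast h
  -- distinct representatives
  have hne : ∀ l ∈ Λ, l + w b' - w b ≠ 0 := by
    intro l hl h
    have hl' : l = w b - w b' := by
      rw [← sub_eq_zero, ← h]; abel
    obtain ⟨c, -, hc⟩ := hB b
    have e1 := hc b ⟨hb, 0, h0Λ, fun x => by
      have := hsmul' x 0 0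
      rw [zero_smul, zero_mul] at this
      rw [this]; simp [dotp]⟩
    have e2 := hc b' ⟨Finset.mem_of_mem_erase hb', l, hl, fun x => by
      rw [hl', hsub', hw]
      simp only [hv]
      simp [dotp, sub_mul, Finset.sum_sub_distrib]⟩
    exact Finset.ne_of_mem_erase hb' (e2.trans e1.symm)
  -- local upper bound
  have hup : ∀ h, Q h h ≤ δ / 4 → thetaGenOf Λ Q r v b (x0 + h) ≤
      Q r (x0 + h) + (1/2) * Q (x0 + h) (x0 + h) - (1/2) * Q h h := by
    intro h hh
    rw [hset]
    refine csSup_le ⟨_, 0, h0Λ, rfl⟩ ?_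
    rintro t ⟨l, hl, rfl⟩
    have e : l + w b - r - (x0 + h) = l - h := by rw [hx0]; abel
    rw [e]
    suffices Q h h ≤ Q (l - h) (l - h) by linarith
    by_cases hl0 : l = 0
    · subst hl0
      rw [zero_sub, ← neg_one_smul ℝ h, hsmul, hsmul']
      linarith
    · have h1 := hdisc l hl hl0
      have h2 := hCS l h
      simp only [hsub, hsub']
      rw [hsym h l]
      have h3 : 2 * Q l h ≤ Q l l := by
        apply le_of_sq_le_sq _ (hnn l)
        nlinarith [hnn l]
      linarith
  have hlow : Q r x0 + (1/2) * Q x0 x0 ≤ thetaGenOf Λ Q r v b x0 := by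
    have := hge b x0 0 h0Λ
    have e : 0 + w b - r - x0 = (0:ℝ) • x0 := by rw [hx0]; simp
    rw [e, hsmul] at this
    linarith
  have key : ∀ η > 0, ∃ l ∈ Λ, δ * Q (l + w b' - w b) (l + w b' - w b) < η ^ 2 := by
    intro η hη
    obtain ⟨t, ⟨l, hl, rfl⟩, hlt⟩ := exists_lt_of_lt_csSup
      (s := {t | ∃ l ∈ Λ, t = Q r x0 + (1/2) * Q x0 x0
      - (1/2) * Q (l + w b' - r - x0) (l + w b' - r - x0)}) ⟨_, 0, h0Λ, rfl⟩
      (b := thetaGenOf Λ Q r v b' x0 - η / 2) (by rw [← hset]; linarith)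
    refine ⟨l, hl, ?_⟩
    have e : l + w b' - r - x0 = l + w b' - w b := by rw [hx0]; abel
    rw [e] at hlt
    have hd := hpos _ (hne l hl)
    set d := l + w b' - w b with hdd
    set t := Real.sqrt (δ / 4 / Q d d) with ht
    have ht0 : 0 ≤ t := Real.sqrt_nonneg _
    have ht2 : t ^ 2 * Q d d = δ / 4 := by
      rw [ht, Real.sq_sqrt (by positivity)]
      field_simp
    have hh : Q (t • d) (t • d) = δ / 4 := by
      rw [hsmul, hsmul', ← ht2]; ring
    have h1 := hup (t • d) hh.le
    have h2 := hge b' (x0 + t • d) l hl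
    have h3 := hLe (x0 + t • d)
    have e' : l + w b' - r - (x0 + t • d) = d - t • d := by rw [hdd, hx0]; abel
    rw [e'] at h2
    have e3 : Q (d - t • d) (d - t • d) = Q d d - 2 * (t * Q d d) + Q (t • d) (t • d) := by
      simp only [hsub, hsub', hsmul, hsmul']; ring
    rw [e3] at h2
    have h4 : 2 * (t * Q d d) < η := by linarith
    have h5 : 0 ≤ 2 * (t * Q d d) := by positivity
    calc δ * Q d d = (2 * (t * Q d d)) ^ 2 := by
          have : δ = 4 * (t ^ 2 * Q d d) := by rw [ht2]; ring
          rw [this]; ring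
      _ < η ^ 2 := by gcongr
  obtain ⟨l, hl, h1⟩ := key (δ / 2) (by positivity)
  have hd := hpos _ (hne l hl)
  set d := l + w b' - w b with hdd
  obtain ⟨l', hl', h2⟩ := key (Real.sqrt (δ * Q d d)) (by positivity)
  rw [Real.sq_sqrt (by positivity)] at h2
  set d' := l' + w b' - w b with hdd'
  have h3 : Q d' d' < Q d d := lt_of_mul_lt_mul_left h2 hδ.le
  have h4 : Q d d < δ / 4 := by
    have : δ * Q d d < δ * (δ / 4) := by nlinarith
    exact lt_of_mul_lt_mul_left this hδ.le
  have hll : l - l' = d - d' := by rw [hdd, hdd']; abel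
  by_cases h0 : l - l' = 0
  · rw [hll, sub_eq_zero] at h0
    rw [h0] at h3
    exact lt_irrefl _ h3
  · have h5 := hdisc _ (hsubΛ l hl l' hl') h0
    rw [hll] at h5
    have h6 := hnn (d + d')
    simp only [hsub, hsub'] at h5
    simp only [hadd, hadd'] at h6
    linarith
end
end

section
/- Let Λ be a lattice in ℝ^n, let Q be a positive definite symmetric bilinear form on ℝ^n that is integral with respect to Λ, fix r ∈ ℝ^n, let b ∈ ℤ^n, and let Θ be a theta function for (Q, Q(·,r)). Then the infimum φ^b(Θ) = inf_{x∈ℝ^n}(Θ(x) − Θ_b(x)) is attained and equals −Θ̂(b) + (1/2)Q(v_b−r, v_b−r), where Θ̂(b) = sup_{x∈ℝ^n}(⟨b,x⟩ − Θ(x)). -/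
noncomputable section

/-- Existence of a maximiser of ⟨b,x⟩ − Θ(x). -/
theorem exists_max_aux {n : ℕ} (Λ : Set (Fin n → ℝ)) (hΛ : IsLattice Λ)
    (Q : (Fin n → ℝ) → (Fin n → ℝ) → ℝ) (hQ : IsSymmBilin Q)
    (hpos : ∀ x : Fin n → ℝ, x ≠ 0 → 0 < Q x x)
    (r w : Fin n → ℝ) (β : Fin n → ℝ) (hw : ∀ x, Q w x = dotp β x)
    (Θ : (Fin n → ℝ) → ℝ) (hΘ : IsThetaFn Λ Q (fun x => Q x r) Θ) :
    ∃ x0, ∀ x, dotp β x - Θ x ≤ dotp β x0 - Θ x0 := by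
  obtain ⟨hlin, hsymm⟩ := hQ
  obtain ⟨hconv, -, hqp⟩ := hΘ
  have hadd : ∀ x y z, Q x (y + z) = Q x y + Q x z := fun x => (hlin x).map_add
  have hsmul : ∀ x (c : ℝ) y, Q x (c • y) = c * Q x y := fun x => (hlin x).map_smul
  have hadd' : ∀ x y z, Q (x + y) z = Q x z + Q y z := fun x y z => by
    rw [hsymm, hadd, hsymm z x, hsymm z y]
  have hsmul' : ∀ (c : ℝ) x y, Q (c • x) y = c * Q x y := fun c x y => by
    rw [hsymm, hsmul, hsymm y x]
  let B : (Fin n → ℝ) →ₗ[ℝ] (Fin n → ℝ) →ₗ[ℝ] ℝ :=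
    LinearMap.mk₂ ℝ Q hadd' hsmul' hadd (fun c x y => hsmul x c y)
  let B' : (Fin n → ℝ) →L[ℝ] (Fin n → ℝ) →L[ℝ] ℝ :=
    LinearMap.toContinuousLinearMap
      ((LinearMap.toContinuousLinearMap :
        ((Fin n → ℝ) →ₗ[ℝ] ℝ) ≃ₗ[ℝ] ((Fin n → ℝ) →L[ℝ] ℝ)).toLinearMap ∘ₗ B)
  have hB : ∀ x y, Q x y = B' x y := fun x y => rfl
  have hΘc : Continuous Θ := hconv.locallyLipschitz.continuous
  have hQc : Continuous fun x => Q x x := by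
    simp only [hB]; fun_prop
  have hQr : Continuous fun x => Q x r := by
    simp only [hB]; fun_prop
  have hQw : Continuous fun x => Q w x := by
    simp only [hB]; fun_prop
  -- coercivity
  obtain ⟨c, hc0, hc⟩ : ∃ c > 0, ∀ x, c * ‖x‖ ^ 2 ≤ Q x x := by
    obtain ⟨c, hc0, hc⟩ := (isCompact_sphere (0 : Fin n → ℝ) 1).exists_forall_le' (f := fun x => Q x x)
      hQc.continuousOn (a := 0) (fun x hx => hpos x (by
        rintro rfl; simp at hx))
    refine ⟨c, hc0, fun x => ?_⟩
    rcases eq_or_ne x 0 with rfl | hx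
    · have := hsmul 0 0 0
      simp at this; simp [this]
    · have hx' : ‖x‖ ≠ 0 := norm_ne_zero_iff.2 hx
      have h1 := hc (‖x‖⁻¹ • x) (by simp [norm_smul, hx'])
      simp only [hsmul, hsmul'] at h1
      have h2 : 0 < ‖x‖ ^ 2 := by positivity
      calc c * ‖x‖ ^ 2 ≤ (‖x‖⁻¹ * (‖x‖⁻¹ * Q x x)) * ‖x‖ ^ 2 := by gcongr
        _ = Q x x := by field_simp
  -- periodic part bounded below
  obtain ⟨m, hm⟩ : ∃ m, ∀ x, m ≤ Θ x - (1/2) * Q x x - Q x r := by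
    obtain ⟨e, rfl⟩ := hΛ
    have hgc : Continuous fun x => Θ x - (1/2) * Q x x - Q x r :=
      (hΘc.sub (continuous_const.mul hQc)).sub hQr
    obtain ⟨m, hm⟩ := ((isCompact_closedBall (0 : Fin n → ℝ) (∑ i, ‖e i‖)).image hgc).bddBelow
    refine ⟨m, fun x => ?_⟩
    set y := ∑ i, Int.fract (e.repr x i) • e i with hy
    set l := ∑ i, ((⌊e.repr x i⌋ : ℤ) : ℝ) • e i with hl
    have hx : x = y + l := by
      conv_lhs => rw [← e.sum_repr x]
      rw [hy, hl, ← Finset.sum_add_distrib]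
      refine Finset.sum_congr rfl fun i _ => ?_
      rw [← add_smul, Int.fract_add_floor]
    have h1 := hqp l ⟨_, hl⟩ y
    have h2 := hm ⟨y, by
      rw [mem_closedBall_zero_iff, hy]
      refine (norm_sum_le _ _).trans (Finset.sum_le_sum fun i _ => ?_)
      rw [norm_smul, Real.norm_of_nonneg (Int.fract_nonneg _)]
      exact mul_le_of_le_one_left (norm_nonneg _) (Int.fract_lt_one _).le, rfl⟩
    simp only at h1 h2
    rw [hx, h1]
    simp only [hadd, hadd']
    rw [hsymm y l]
    linarith
  have hfc : Continuous fun x => dotp β x - Θ x := by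
    simp only [← hw]; exact hQw.sub hΘc
  set f := fun x => dotp β x - Θ x with hf
  refine hfc.exists_forall_ge' 0 ?_
  set C := ‖B' (w - r)‖ with hC
  filter_upwards [(tendsto_norm_cocompact_atTop (E := Fin n → ℝ)).eventually_ge_atTop
    (max 1 (2 * (C + |f 0 + m|) / c))] with x hx
  have hx1 : 1 ≤ ‖x‖ := (le_max_left _ _).trans hx
  have hx2 : 2 * (C + |f 0 + m|) / c ≤ ‖x‖ := (le_max_right _ _).trans hx
  rw [div_le_iff₀ hc0] at hx2
  have h1 : Q w x - Q x r ≤ C * ‖x‖ := by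
    have h := (le_abs_self _).trans ((B' (w - r)).le_opNorm x)
    rw [← hC] at h
    rw [hsymm x r]
    rw [hB w x, hB r x]
    simpa only [map_sub, ContinuousLinearMap.sub_apply] using h
  have h2 := hm x
  have h3 := hc x
  have h4 : -|f 0 + m| ≤ f 0 + m := neg_abs_le _
  have h5 : 0 ≤ |f 0 + m| := abs_nonneg _
  have h6 : f x = Q w x - Θ x := by rw [hw]
  change f x ≤ f 0
  rw [h6]
  nlinarith [mul_le_mul_of_nonneg_left hx2 (norm_nonneg x), mul_le_mul_of_nonneg_right hx1 h5]

theorem stmt8 {n : ℕ} (Λ : Set (Fin n → ℝ)) (hΛ : IsLattice Λ)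
    (Q : (Fin n → ℝ) → (Fin n → ℝ) → ℝ) (hQ : IsSymmBilin Q)
    (hpos : ∀ x : Fin n → ℝ, x ≠ 0 → 0 < Q x x) (hint : IntegralWrt Q Λ)
    (r : Fin n → ℝ) (v : (Fin n → ℝ) → (Fin n → ℝ))
    (hv : ∀ a x, Q (v a) x = dotp a x) (b : Fin n → ℤ)
    (Θ : (Fin n → ℝ) → ℝ) (hΘ : IsThetaFn Λ Q (fun x => Q x r) Θ) :
    IsLeast {t | ∃ x : Fin n → ℝ, t = Θ x - thetaGenOf Λ Q r v b x}
      (-(legendreT Θ (fun i => (b i : ℝ)))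
        + (1/2) * Q (v (fun i => (b i : ℝ)) - r) (v (fun i => (b i : ℝ)) - r)) := by
  obtain ⟨x0, hx0⟩ := exists_max_aux Λ hΛ Q hQ hpos r _ _ (hv (fun i => (b i : ℝ))) Θ hΘ
  have hL : legendreT Θ (fun i => (b i : ℝ)) = dotp (fun i => (b i : ℝ)) x0 - Θ x0 := by
    refine IsGreatest.csSup_eq ⟨⟨x0, rfl⟩, ?_⟩
    rintro t ⟨x, rfl⟩
    exact hx0 x
  obtain ⟨hlin, hsymm⟩ := hQ
  obtain ⟨-, -, hqp⟩ := hΘ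
  have hadd : ∀ x y z, Q x (y + z) = Q x y + Q x z := fun x => (hlin x).map_add
  have hsub : ∀ x y z, Q x (y - z) = Q x y - Q x z := fun x => (hlin x).map_sub
  have hadd' : ∀ x y z, Q (x + y) z = Q x z + Q y z := fun x y z => by
    rw [hsymm, hadd, hsymm z x, hsymm z y]
  have hsub' : ∀ x y z, Q (x - y) z = Q x z - Q y z := fun x y z => by
    rw [hsymm, hsub, hsymm z x, hsymm z y]
  set β : Fin n → ℝ := fun i => (b i : ℝ) with hβ
  set w := v β with hw
  have h0 : (0 : Fin n → ℝ) ∈ Λ := by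
    obtain ⟨e, rfl⟩ := hΛ
    exact ⟨0, by simp⟩
  have key : ∀ x, ∀ l ∈ Λ, dotp β x + Q l x - (1/2) * Q (l + w - r) (l + w - r)
      ≤ Θ x + (dotp β x0 - Θ x0) - (1/2) * Q (w - r) (w - r) := by
    intro x l hl
    have h1 := hqp l hl (x - l)
    have h2 := hx0 (x - l)
    simp only [sub_add_cancel] at h1
    rw [← hv β (x - l)] at h2
    rw [← hv β x]
    simp only [hadd, hadd', hsub, hsub', ← hw] at h1 h2 ⊢
    rw [hsymm l w, hsymm r l, hsymm r w]
    linarith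
  have hz : ∀ x, Q 0 x = 0 := fun x => by
    have := hadd' 0 0 x
    simp at this; exact this
  rw [hL]
  constructor
  · refine ⟨x0, ?_⟩
    have : thetaGenOf Λ Q r v b x0 = dotp β x0 - (1/2) * Q (w - r) (w - r) := by
      refine IsGreatest.csSup_eq ⟨⟨0, h0, ?_⟩, ?_⟩
      · simp [hz, hβ, hw]
      · rintro t ⟨l, hl, rfl⟩
        have := key x0 l hl
        linarith
    rw [this]; ring
  · rintro t ⟨x, rfl⟩
    have : thetaGenOf Λ Q r v b x ≤ Θ x + (dotp β x0 - Θ x0) - (1/2) * Q (w - r) (w - r) := by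
      refine csSup_le ⟨_, 0, h0, rfl⟩ ?_
      rintro t ⟨l, hl, rfl⟩
      exact key x l hl
    linarith
end
end

section
/- Let Λ be a lattice in ℝ^n, let Q be a positive definite symmetric bilinear form on ℝ^n that is integral with respect to Λ, fix r ∈ ℝ^n, and let B ⊂ ℤ^n be a complete set of representatives of the quotient group ℤ^n/q(Λ). Then every theta function Θ for (Q, Q(·,r)) satisfies Θ(x) = max_{b∈B}(Θ_b(x) + φ^b(Θ)) for all x ∈ ℝ^n, where φ^b(Θ) = inf_{y∈ℝ^n}(Θ(y) − Θ_b(y)). In particular, the map sending a theta function Θ to the tuple (φ^b(Θ))_{b∈B} ∈ ℝ^B is injective on the set of theta functions for (Q, Q(·,r)). -/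
noncomputable section

theorem qq_cont {n : ℕ} (Q : (Fin n → ℝ) → (Fin n → ℝ) → ℝ) (hQ : IsSymmBilin Q) :
    Continuous fun x => Q x x := by
  have hlin : ∀ z, Continuous (Q z) := fun z =>
    (IsLinearMap.mk' (Q z) (hQ.1 z)).continuous_of_finiteDimensional
  have h : (fun x => Q x x) = fun x => ∑ i, x i * Q (Pi.single i 1) x := by
    funext x
    have h1 := (IsLinearMap.mk' (Q x) (hQ.1 x)).pi_apply_eq_sum_univ x
    simp only [IsLinearMap.mk'_apply, smul_eq_mul] at h1
    rw [h1]
    refine Finset.sum_congr rfl fun i _ => ?_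
    rw [hQ.2 x]
    congr 2
    funext j
    simp [Pi.single_apply, eq_comm]
  rw [h]
  exact continuous_finsetSum _ fun i _ => (continuous_apply i).mul (hlin _)

theorem lattice_cover {n : ℕ} (Λ : Set (Fin n → ℝ)) (hΛ : IsLattice Λ) :
    ∃ K : Set (Fin n → ℝ), IsCompact K ∧ ∀ x, ∃ l ∈ Λ, x + l ∈ K := by
  obtain ⟨e, rfl⟩ := hΛ
  have hc : Continuous fun t : Fin n → ℝ => ∑ i, t i • e i := by fun_prop
  refine ⟨Set.image (fun t : Fin n → ℝ => ∑ i, t i • e i) (Set.Icc 0 1), isCompact_Icc.image hc, ?_⟩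
  intro x
  refine ⟨_, ⟨fun i => -⌊e.repr x i⌋, rfl⟩, fun i => Int.fract (e.repr x i), ?_, ?_⟩
  · exact ⟨fun i => Int.fract_nonneg _, fun i => (Int.fract_lt_one _).le⟩
  · conv_rhs => rw [← e.sum_repr x]
    rw [← Finset.sum_add_distrib]
    refine Finset.sum_congr rfl fun i _ => ?_
    rw [e.sum_repr, ← add_smul]
    congr 1
    have h := Int.self_sub_floor (e.repr x i)
    push_cast
    linarith

theorem lattice_sub {n : ℕ} {Λ : Set (Fin n → ℝ)} (hΛ : IsLattice Λ) {a b : Fin n → ℝ}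
    (ha : a ∈ Λ) (hb : b ∈ Λ) : a - b ∈ Λ := by
  obtain ⟨e, rfl⟩ := hΛ
  obtain ⟨c, rfl⟩ := ha
  obtain ⟨d, rfl⟩ := hb
  refine ⟨c - d, ?_⟩
  rw [← Finset.sum_sub_distrib]
  refine Finset.sum_congr rfl fun i _ => ?_
  rw [← sub_smul]; simp

theorem stmt9_main {n : ℕ} (Λ : Set (Fin n → ℝ)) (hΛ : IsLattice Λ)
    (Q : (Fin n → ℝ) → (Fin n → ℝ) → ℝ) (hQ : IsSymmBilin Q)
    (hpos : ∀ x : Fin n → ℝ, x ≠ 0 → 0 < Q x x)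
    (r : Fin n → ℝ) (v : (Fin n → ℝ) → (Fin n → ℝ))
    (hv : ∀ a x, Q (v a) x = dotp a x)
    (B : Finset (Fin n → ℤ))
    (hB : ∀ m : Fin n → ℤ, ∃! b, b ∈ B ∧
      InQLat Λ Q (fun i => (m i : ℝ) - (b i : ℝ)))
    (Θ : (Fin n → ℝ) → ℝ) (hΘ : IsThetaFn Λ Q (fun x => Q x r) Θ)
    (x : Fin n → ℝ) :
        IsGreatest {t | ∃ b ∈ B, t = thetaGenOf Λ Q r v b x + phiB Λ Q r v b Θ} (Θ x) := by
  obtain ⟨hconv, hreg, hqp⟩ := hΘ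
  have addr : ∀ x y z, Q x (y + z) = Q x y + Q x z := fun x y z => (hQ.1 x).map_add y z
  have subr : ∀ x y z, Q x (y - z) = Q x y - Q x z := fun x y z => (hQ.1 x).map_sub y z
  have addl : ∀ x y z, Q (y + z) x = Q y x + Q z x := fun x y z => by
    rw [hQ.2, addr, hQ.2 x y, hQ.2 x z]
  have subl : ∀ x y z, Q (y - z) x = Q y x - Q z x := fun x y z => by
    rw [hQ.2, subr, hQ.2 x y, hQ.2 x z]
  have nonneg : ∀ x, 0 ≤ Q x x := fun x => by
    by_cases h : x = 0
    · subst h; rw [(hQ.1 0).map_zero]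
    · exact (hpos x h).le
  obtain ⟨z0, hz0⟩ : Λ.Nonempty := by
    obtain ⟨K, -, hK⟩ := lattice_cover Λ hΛ
    obtain ⟨l, hl, -⟩ := hK 0
    exact ⟨l, hl⟩
  -- upper bound for the terms of the generator
  have hterm : ∀ (b : Fin n → ℤ) (y l : Fin n → ℝ),
      dotp (fun i => (b i : ℝ)) y + Q l y
        - (1/2) * Q (l + v (fun i => (b i : ℝ)) - r) (l + v (fun i => (b i : ℝ)) - r)
      ≤ 1/2 * Q y y + Q y r := by
    intro b y l
    have h0 := nonneg (l + v (fun i => (b i : ℝ)) - r - y)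
    rw [← hv]
    generalize v (fun i => (b i : ℝ)) = w at *
    rw [subr _ _ y, subl _ _ y, subl _ _ y] at h0
    have h1 := hQ.2 y (l + w - r)
    have h2 : Q (l + w - r) y = Q l y + Q w y - Q y r := by
      rw [subl, addl, hQ.2 r]
    linarith
  have hbdd : ∀ (b : Fin n → ℤ) (y : Fin n → ℝ), BddAbove {t | ∃ l ∈ Λ,
      t = dotp (fun i => (b i : ℝ)) y + Q l y
        - (1/2) * Q (l + v (fun i => (b i : ℝ)) - r) (l + v (fun i => (b i : ℝ)) - r)} := by
    intro b y
    refine ⟨1/2 * Q y y + Q y r, ?_⟩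
    rintro _ ⟨l, _, rfl⟩
    exact hterm b y l
  have hgen_le : ∀ (b : Fin n → ℤ) (y : Fin n → ℝ),
      thetaGenOf Λ Q r v b y ≤ 1/2 * Q y y + Q y r := by
    intro b y
    refine csSup_le ⟨_, z0, hz0, rfl⟩ ?_
    rintro _ ⟨l, _, rfl⟩
    exact hterm b y l
  -- lower bound for Θ
  obtain ⟨C, hC⟩ : ∃ C, ∀ y, C ≤ Θ y - (1/2 * Q y y + Q y r) := by
    obtain ⟨K, hKc, hK⟩ := lattice_cover Λ hΛ
    have hcΘ : Continuous Θ := by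
      rw [← continuousOn_univ]
      exact hconv.continuousOn isOpen_univ
    have hcr : Continuous fun y => Q y r := by
      have : (fun y => Q y r) = Q r := by funext y; exact hQ.2 _ _
      rw [this]
      exact (IsLinearMap.mk' (Q r) (hQ.1 r)).continuous_of_finiteDimensional
    have hcF : Continuous fun y => Θ y - (1/2 * Q y y + Q y r) :=
      hcΘ.sub (((qq_cont Q hQ).const_mul _).add hcr)
    obtain ⟨C, hC⟩ := (hKc.image hcF).bddBelow
    refine ⟨C, fun y => ?_⟩
    obtain ⟨l, hl, hyl⟩ := hK y
    have h1 := hC ⟨_, hyl, rfl⟩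
    simp only at h1
    rw [hqp l hl y, addl r, addr, addl, addl, hQ.2 y l] at h1
    linarith
  have hbelow : ∀ b : Fin n → ℤ, BddBelow {u | ∃ y, u = Θ y - thetaGenOf Λ Q r v b y} := by
    intro b
    refine ⟨C, ?_⟩
    rintro _ ⟨y, rfl⟩
    linarith [hC y, hgen_le b y]
  have hupper : ∀ b : Fin n → ℤ, thetaGenOf Λ Q r v b x + phiB Λ Q r v b Θ ≤ Θ x := by
    intro b
    have : phiB Λ Q r v b Θ ≤ Θ x - thetaGenOf Λ Q r v b x := csInf_le (hbelow b) ⟨x, rfl⟩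
    linarith
  refine ⟨?_, ?_⟩
  swap
  · rintro _ ⟨b, _, rfl⟩
    exact hupper b
  -- supporting affine function
  obtain ⟨a, c, hax, hay⟩ : ∃ (a : Fin n → ℤ) (c : ℝ),
      Θ x = dotp (fun j => (a j : ℝ)) x + c ∧ ∀ y, dotp (fun j => (a j : ℝ)) y + c ≤ Θ y := by
    obtain ⟨U, hU, k, a, c, h⟩ := hreg x
    obtain ⟨i, -, hi⟩ := Finset.exists_mem_eq_sup' Finset.univ_nonempty
      (fun i => dotp (fun j => (a i j : ℝ)) x + c i)
    have hx := (h x (mem_of_mem_nhds hU)).trans hi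
    refine ⟨a i, c i, hx, ?_⟩
    set w := v (fun j => (a i j : ℝ)) with hw
    have hcv : ConvexOn ℝ Set.univ (fun y => Θ y + (IsLinearMap.mk' _ (hQ.1 (-w))) y) :=
      hconv.add ((IsLinearMap.mk' _ (hQ.1 (-w))).convexOn convex_univ)
    have hneg : ∀ y, Q (-w) y = - dotp (fun j => (a i j : ℝ)) y := by
      intro y
      rw [hQ.2, (hQ.1 y).map_neg, hQ.2, hw, hv]
    have hloc : IsLocalMin (fun y => Θ y + (IsLinearMap.mk' _ (hQ.1 (-w))) y) x := by
      filter_upwards [hU] with y hy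
      simp only [IsLinearMap.mk'_apply, hneg]
      have h2 := Finset.le_sup' (fun i => dotp (fun j => (a i j : ℝ)) y + c i)
        (Finset.mem_univ i)
      rw [← h y hy] at h2
      linarith
    have hmin := IsMinOn.of_isLocalMin_of_convex_univ hloc hcv
    intro y
    have h3 := hmin y
    simp only [IsLinearMap.mk'_apply, hneg] at h3
    linarith
  obtain ⟨b, ⟨hbB, l0, hl0, hl0x⟩, -⟩ := hB a
  refine ⟨b, hbB, le_antisymm ?_ (hupper b)⟩
  have hdot : ∀ y, dotp (fun j => (a j : ℝ)) y = dotp (fun j => (b j : ℝ)) y + Q l0 y := by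
    intro y
    rw [← hl0x]
    simp only [dotp, ← Finset.sum_add_distrib]
    refine Finset.sum_congr rfl fun i _ => by ring
  have hgx : dotp (fun j => (b j : ℝ)) x + Q l0 x
        - (1/2) * Q (l0 + v (fun i => (b i : ℝ)) - r) (l0 + v (fun i => (b i : ℝ)) - r)
      ≤ thetaGenOf Λ Q r v b x := le_csSup (hbdd b x) ⟨l0, hl0, rfl⟩
  have hphi : c + (1/2) * Q (l0 + v (fun i => (b i : ℝ)) - r) (l0 + v (fun i => (b i : ℝ)) - r)
      ≤ phiB Λ Q r v b Θ := by
    refine le_csInf ⟨_, 0, rfl⟩ ?_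
    rintro _ ⟨y, rfl⟩
    rw [le_sub_comm]
    refine csSup_le ⟨_, z0, hz0, rfl⟩ ?_
    rintro _ ⟨l', hl', rfl⟩
    have h1 := hay (y + (l0 - l'))
    rw [hqp _ (lattice_sub hΛ hl0 hl') y, hdot, ← hv] at h1
    rw [← hv]
    generalize v (fun i => (b i : ℝ)) = w at *
    simp only [addl, addr, subl, subr] at h1 ⊢
    linarith [hQ.2 l0 l', hQ.2 l0 w, hQ.2 l0 r, hQ.2 l' w, hQ.2 l' r, hQ.2 w r]
  rw [hax, hdot]
  linarith

theorem stmt9 {n : ℕ} (Λ : Set (Fin n → ℝ)) (hΛ : IsLattice Λ)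
    (Q : (Fin n → ℝ) → (Fin n → ℝ) → ℝ) (hQ : IsSymmBilin Q)
    (hpos : ∀ x : Fin n → ℝ, x ≠ 0 → 0 < Q x x) (hint : IntegralWrt Q Λ)
    (r : Fin n → ℝ) (v : (Fin n → ℝ) → (Fin n → ℝ))
    (hv : ∀ a x, Q (v a) x = dotp a x)
    (B : Finset (Fin n → ℤ))
    (hB : ∀ m : Fin n → ℤ, ∃! b, b ∈ B ∧
      InQLat Λ Q (fun i => (m i : ℝ) - (b i : ℝ))) :
    (∀ Θ : (Fin n → ℝ) → ℝ, IsThetaFn Λ Q (fun x => Q x r) Θ →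
      ∀ x : Fin n → ℝ,
        IsGreatest {t | ∃ b ∈ B, t = thetaGenOf Λ Q r v b x + phiB Λ Q r v b Θ} (Θ x)) ∧
    (∀ Θ₁ Θ₂ : (Fin n → ℝ) → ℝ, IsThetaFn Λ Q (fun x => Q x r) Θ₁ →
      IsThetaFn Λ Q (fun x => Q x r) Θ₂ →
      (∀ b ∈ B, phiB Λ Q r v b Θ₁ = phiB Λ Q r v b Θ₂) → Θ₁ = Θ₂) := by
  have main := fun Θ hΘ x => stmt9_main Λ hΛ Q hQ hpos r v hv B hB Θ hΘ x
  refine ⟨main, fun Θ₁ Θ₂ h₁ h₂ h => ?_⟩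
  funext x
  have m₁ := main Θ₁ h₁ x
  have m₂ := main Θ₂ h₂ x
  refine le_antisymm ?_ ?_
  · obtain ⟨b, hb, e⟩ := m₁.1
    exact m₂.2 ⟨b, hb, by rw [e, h b hb]⟩
  · obtain ⟨b, hb, e⟩ := m₂.1
    exact m₁.2 ⟨b, hb, by rw [e, h b hb]⟩
end
end

section
/- Let Λ be a lattice in ℝ^n, let Q be a positive definite symmetric bilinear form on ℝ^n that is integral with respect to Λ, fix r ∈ ℝ^n, and let B ⊂ ℤ^n be a complete set of representatives of ℤ^n/q(Λ), with at least two elements. For t = (t_b)_{b∈B} ∈ ℝ^B let Θ_t(x) = max_{b∈B}(Θ_b(x) + t_b). Then φ^b(Θ_t) = t_b holds for all b ∈ B if and only if for every b ∈ B one has t_b ≥ inf_{x∈ℝ^n}( max_{b'∈B, b'≠b}(Θ_{b'}(x) + t_{b'}) − Θ_b(x) ), where φ^b(Θ) = inf_{y∈ℝ^n}(Θ(y) − Θ_b(y)). -/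
noncomputable section

lemma quad_bound {n : ℕ} (e : Module.Basis (Fin n) ℝ (Fin n → ℝ))
    (Q : (Fin n → ℝ) → (Fin n → ℝ) → ℝ) (hQ : IsSymmBilin Q) :
    ∃ C : ℝ, ∀ f : Fin n → ℝ, (∀ i, 0 ≤ f i ∧ f i ≤ 1) →
      Q (∑ i, f i • e i) (∑ i, f i • e i) ≤ C := by
  refine ⟨∑ i, ∑ j, |Q (e i) (e j)|, fun f hf => ?_⟩
  have hs : ∀ (x : Fin n → ℝ) (g : Fin n → ℝ),
      Q x (∑ i, g i • e i) = ∑ i, g i * Q x (e i) := by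
    intro x g
    have := map_sum (IsLinearMap.mk' (Q x) (hQ.1 x)) (fun i => g i • e i) Finset.univ
    refine this.trans (Finset.sum_congr rfl fun i _ => ?_)
    exact (hQ.1 x).map_smul (g i) (e i)
  rw [hs]
  refine Finset.sum_le_sum fun i _ => ?_
  rw [hQ.2, hs, Finset.mul_sum]
  refine Finset.sum_le_sum fun j _ => ?_
  have h1 : f i * (f j * Q (e i) (e j)) ≤ f i * (f j * |Q (e i) (e j)|) := by
    have := hf i
    have := hf j
    exact mul_le_mul_of_nonneg_left
      (mul_le_mul_of_nonneg_left (le_abs_self _) (hf j).1) (hf i).1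
  have h2 : f j * |Q (e i) (e j)| ≤ |Q (e i) (e j)| :=
    mul_le_of_le_one_left (abs_nonneg _) (hf j).2
  have h3 : f i * (f j * |Q (e i) (e j)|) ≤ f j * |Q (e i) (e j)| :=
    mul_le_of_le_one_left (mul_nonneg (hf j).1 (abs_nonneg _)) (hf i).2
  linarith

lemma theta_bounds {n : ℕ} (Λ : Set (Fin n → ℝ)) (hΛ : IsLattice Λ)
    (Q : (Fin n → ℝ) → (Fin n → ℝ) → ℝ) (hQ : IsSymmBilin Q)
    (hpos : ∀ x : Fin n → ℝ, x ≠ 0 → 0 < Q x x)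
    (r : Fin n → ℝ) (v : (Fin n → ℝ) → (Fin n → ℝ))
    (hv : ∀ a x, Q (v a) x = dotp a x) :
    ∃ C : ℝ, ∀ b x, thetaGenOf Λ Q r v b x ≤ Q r x + (1/2) * Q x x ∧
      Q r x + (1/2) * Q x x - C ≤ thetaGenOf Λ Q r v b x := by
  obtain ⟨e, rfl⟩ := hΛ
  obtain ⟨C, hC⟩ := quad_bound e Q hQ
  have addr : ∀ x y z, Q x (y + z) = Q x y + Q x z := fun x => (hQ.1 x).map_add
  have subr : ∀ x y z, Q x (y - z) = Q x y - Q x z := fun x => (hQ.1 x).map_sub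
  have addl : ∀ x y z, Q (y + z) x = Q y x + Q z x := fun x y z => by
    rw [hQ.2, addr, hQ.2 x, hQ.2 x]
  have subl : ∀ x y z, Q (y - z) x = Q y x - Q z x := fun x y z => by
    rw [hQ.2, subr, hQ.2 x, hQ.2 x]
  have nonneg : ∀ x, 0 ≤ Q x x := by
    intro x
    by_cases h : x = 0
    · subst h
      exact ((hQ.1 0).map_zero).ge
    · exact (hpos x h).le
  have key : ∀ (b : Fin n → ℤ) (x l : Fin n → ℝ),
      dotp (fun i => (b i : ℝ)) x + Q l x
        - (1/2) * Q (l + v (fun i => (b i : ℝ)) - r) (l + v (fun i => (b i : ℝ)) - r)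
      = Q r x + (1/2) * Q x x
        - (1/2) * Q (r + x - v (fun i => (b i : ℝ)) - l)
          (r + x - v (fun i => (b i : ℝ)) - l) := by
    intro b x l
    rw [← hv]
    generalize v (fun i => (b i : ℝ)) = w
    simp only [addr, subr, addl, subl]
    rw [hQ.2 x r, hQ.2 w r, hQ.2 w x, hQ.2 l r, hQ.2 l x, hQ.2 l w]
    ring
  refine ⟨(1/2) * C, fun b x => ?_⟩
  unfold thetaGenOf ThetaGen
  have ub : ∀ s ∈ {t | ∃ l ∈ {x | ∃ c : Fin n → ℤ, x = ∑ i, (c i : ℝ) • e i},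
      t = dotp (fun i => (b i : ℝ)) x + Q l x
      - (1/2) * Q (l + v (fun i => (b i : ℝ)) - r) (l + v (fun i => (b i : ℝ)) - r)},
      s ≤ Q r x + (1/2) * Q x x := by
    rintro s ⟨l, -, rfl⟩
    rw [key]
    have := nonneg (r + x - v (fun i => (b i : ℝ)) - l)
    linarith
  constructor
  · refine csSup_le ⟨_, 0, ⟨0, by simp⟩, rfl⟩ ub
  · set y := r + x - v (fun i => (b i : ℝ)) with hy
    have hl : y - ∑ i, ((⌊e.repr y i⌋ : ℤ) : ℝ) • e i = ∑ i, Int.fract (e.repr y i) • e i := by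
      conv_lhs => rw [← e.sum_repr y]
      rw [← Finset.sum_sub_distrib]
      refine Finset.sum_congr rfl fun i _ => ?_
      rw [e.sum_repr, ← sub_smul]
      rfl
    refine le_trans ?_ (le_csSup ⟨_, ub⟩ ⟨_, ⟨fun i => ⌊e.repr y i⌋, rfl⟩, rfl⟩)
    rw [key, ← hy, hl]
    have := hC (fun i => Int.fract (e.repr y i))
      (fun i => ⟨Int.fract_nonneg _, (Int.fract_lt_one _).le⟩)
    linarith

theorem stmt10 {n : ℕ} (Λ : Set (Fin n → ℝ)) (hΛ : IsLattice Λ)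
    (Q : (Fin n → ℝ) → (Fin n → ℝ) → ℝ) (hQ : IsSymmBilin Q)
    (hpos : ∀ x : Fin n → ℝ, x ≠ 0 → 0 < Q x x) (hint : IntegralWrt Q Λ)
    (r : Fin n → ℝ) (v : (Fin n → ℝ) → (Fin n → ℝ))
    (hv : ∀ a x, Q (v a) x = dotp a x)
    (B : Finset (Fin n → ℤ))
    (hB : ∀ m : Fin n → ℤ, ∃! b, b ∈ B ∧
      InQLat Λ Q (fun i => (m i : ℝ) - (b i : ℝ)))
    (hcard : 2 ≤ B.card) (t : (Fin n → ℤ) → ℝ) :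
    (∀ b ∈ B, phiB Λ Q r v b
        (fun y => sSup {w | ∃ b' ∈ B, w = thetaGenOf Λ Q r v b' y + t b'}) = t b) ↔
    (∀ b ∈ B,
      sInf {u | ∃ x : Fin n → ℝ,
        u = sSup {w | ∃ b' ∈ B, b' ≠ b ∧ w = thetaGenOf Λ Q r v b' x + t b'}
          - thetaGenOf Λ Q r v b x} ≤ t b) := by
  obtain ⟨C, hC⟩ := theta_bounds Λ hΛ Q hQ hpos r v hv
  refine forall₂_congr fun b hb => ?_
  unfold phiB
  generalize thetaGenOf Λ Q r v = Θ at hC ⊢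
  obtain ⟨b₀, hb₀, hne⟩ : ∃ b₀ ∈ B, b₀ ≠ b := by
    exact Finset.exists_mem_ne (by omega) b
  have fin1 : ∀ x, {w | ∃ b' ∈ B, w = Θ b' x + t b'}.Finite := fun x => by
    refine (B.finite_toSet.image (fun b' => Θ b' x + t b')).subset ?_
    rintro w ⟨b', h, rfl⟩
    exact ⟨b', h, rfl⟩
  have fin2 : ∀ x, {w | ∃ b' ∈ B, b' ≠ b ∧ w = Θ b' x + t b'}.Finite := fun x =>
    (fin1 x).subset (by rintro w ⟨b', h, -, rfl⟩; exact ⟨b', h, rfl⟩)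
  set M : (Fin n → ℝ) → ℝ := fun x => sSup {w | ∃ b' ∈ B, b' ≠ b ∧ w = Θ b' x + t b'} with hM
  have hmax : ∀ x, sSup {w | ∃ b' ∈ B, w = Θ b' x + t b'} = max (M x) (Θ b x + t b) := by
    intro x
    apply le_antisymm
    · refine csSup_le ⟨_, b, hb, rfl⟩ ?_
      rintro w ⟨b', h, rfl⟩
      by_cases hbb : b' = b
      · subst hbb
        exact le_max_right _ _
      · exact le_max_of_le_left (le_csSup (fin2 x).bddAbove ⟨b', h, hbb, rfl⟩)
    · refine max_le ?_ (le_csSup (fin1 x).bddAbove ⟨b, hb, rfl⟩)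
      refine csSup_le ⟨_, b₀, hb₀, hne, rfl⟩ ?_
      rintro w ⟨b', h, -, rfl⟩
      exact le_csSup (fin1 x).bddAbove ⟨b', h, rfl⟩
  have hlow : ∀ x, t b₀ - C ≤ M x - Θ b x := by
    intro x
    have h1 : Θ b₀ x + t b₀ ≤ M x := le_csSup (fin2 x).bddAbove ⟨b₀, hb₀, hne, rfl⟩
    have h2 := (hC b₀ x).2
    have h3 := (hC b x).1
    linarith
  have e1 : {u | ∃ y, u = (fun y => sSup {w | ∃ b' ∈ B, w = Θ b' y + t b'}) y - Θ b y}
      = {u | ∃ y, u = max (M y - Θ b y) (t b)} := by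
    ext u
    refine exists_congr fun y => ?_
    simp only [hmax]
    rw [← max_sub_sub_right, add_sub_cancel_left]
  rw [e1]
  have bd2 : BddBelow {u | ∃ x : Fin n → ℝ, u = M x - Θ b x} :=
    ⟨t b₀ - C, by rintro u ⟨x, rfl⟩; exact hlow x⟩
  have bd1 : BddBelow {u | ∃ y, u = max (M y - Θ b y) (t b)} :=
    ⟨t b, by rintro u ⟨x, rfl⟩; exact le_max_right _ _⟩
  have ne1 : {u | ∃ y, u = max (M y - Θ b y) (t b)}.Nonempty := ⟨_, 0, rfl⟩
  have ne2 : {u | ∃ x : Fin n → ℝ, u = M x - Θ b x}.Nonempty := ⟨_, 0, rfl⟩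
  constructor
  · intro h
    refine le_of_le_of_eq ?_ h
    refine le_of_forall_pos_le_add fun ε hε => ?_
    obtain ⟨u, ⟨y, rfl⟩, hu⟩ := exists_lt_of_csInf_lt ne1
      (lt_add_of_pos_right (sInf {u | ∃ y, u = max (M y - Θ b y) (t b)}) hε)
    exact (csInf_le bd2 ⟨y, rfl⟩).trans ((le_max_left _ _).trans hu.le)
  · intro h
    apply le_antisymm
    · refine le_of_forall_pos_le_add fun ε hε => ?_
      obtain ⟨u, ⟨y, rfl⟩, hu⟩ := exists_lt_of_csInf_lt ne2
        (lt_of_le_of_lt h (lt_add_of_pos_right (t b) hε))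
      exact (csInf_le bd1 ⟨y, rfl⟩).trans (max_le hu.le (by linarith))
    · refine le_csInf ⟨_, (0 : Fin n → ℝ), rfl⟩ ?_
      rintro u ⟨y, rfl⟩
      exact le_max_right _ _
end
end

section
/- Let Λ be a lattice in ℝ^n, let Q be a positive definite symmetric bilinear form on ℝ^n that is integral with respect to Λ, fix r ∈ ℝ^n, and let B ⊂ ℤ^n be a complete set of representatives of ℤ^n/q(Λ). Then the set S = {(φ^b(Θ))_{b∈B} ∈ ℝ^B : Θ is a theta function for (Q, Q(·,r))} is a convex subset of ℝ^B, where φ^b(Θ) = inf_{y∈ℝ^n}(Θ(y) − Θ_b(y)). -/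
noncomputable section

section helpers

variable {n : ℕ}

lemma dotp_add_left (a b x : Fin n → ℝ) : dotp (a + b) x = dotp a x + dotp b x := by
  simp [dotp, add_mul, Finset.sum_add_distrib]

lemma dotp_sub_left (a b x : Fin n → ℝ) : dotp (a - b) x = dotp a x - dotp b x := by
  simp [dotp, sub_mul, Finset.sum_sub_distrib]

lemma dotp_add_right (a x y : Fin n → ℝ) : dotp a (x + y) = dotp a x + dotp a y := by
  simp [dotp, mul_add, Finset.sum_add_distrib]

lemma dotp_smul_right (c : ℝ) (a x : Fin n → ℝ) : dotp a (c • x) = c * dotp a x := by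
  simp only [dotp, Pi.smul_apply, smul_eq_mul, Finset.mul_sum]
  exact Finset.sum_congr rfl fun i _ => by ring

lemma dotp_single (a : Fin n → ℝ) (i : Fin n) (c : ℝ) : dotp a (Pi.single i c) = a i * c := by
  simp [dotp, Pi.single_apply]

/-- the sup of all integral affine functions -/
def supFn (g : (Fin n → ℤ) → ℝ) (x : Fin n → ℝ) : ℝ :=
  ⨆ a : Fin n → ℤ, (dotp (fun i => (a i : ℝ)) x - g a)

lemma supFn_convex (g : (Fin n → ℤ) → ℝ) (h : (Fin n → ℝ) → ℝ)
    (hg : ∀ a y, dotp (fun i => ((a : Fin n → ℤ) i : ℝ)) y - g a ≤ h y) :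
    ConvexOn ℝ Set.univ (supFn g) := by
  have bdd : ∀ y, BddAbove (Set.range fun a : Fin n → ℤ => dotp (fun i => (a i : ℝ)) y - g a) := by
    intro y
    refine ⟨h y, ?_⟩
    rintro _ ⟨a, rfl⟩
    exact hg a y
  refine ⟨convex_univ, ?_⟩
  intro x _ y _ s t hs ht hst
  refine ciSup_le fun a => ?_
  have hx := le_ciSup (bdd x) a
  have hy := le_ciSup (bdd y) a
  rw [dotp_add_right, dotp_smul_right, dotp_smul_right]
  simp only [smul_eq_mul]
  have h1 := mul_le_mul_of_nonneg_left hx hs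
  have h2 := mul_le_mul_of_nonneg_left hy ht
  have h3 : g a = s * g a + t * g a := by rw [← add_mul, hst, one_mul]
  unfold supFn
  linarith

lemma supFn_regular (g : (Fin n → ℤ) → ℝ) (h : (Fin n → ℝ) → ℝ) (hc : Continuous h)
    (hg : ∀ a y, dotp (fun i => ((a : Fin n → ℤ) i : ℝ)) y - g a ≤ h y) :
    RegularFn (supFn g) := by
  intro x
  have bdd : ∀ y, BddAbove (Set.range fun a : Fin n → ℤ => dotp (fun i => (a i : ℝ)) y - g a) := by
    intro y
    refine ⟨h y, ?_⟩
    rintro _ ⟨a, rfl⟩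
    exact hg a y
  obtain ⟨H, hH⟩ := (isCompact_closedBall x 2).bddAbove_image hc.continuousOn
  have hH' : ∀ y ∈ Metric.closedBall x 2, h y ≤ H := fun y hy => hH ⟨y, hy, rfl⟩
  obtain ⟨N, hN⟩ := exists_nat_ge (H + g 0)
  let F : Finset (Fin n → ℤ) := Fintype.piFinset fun _ => Finset.Icc (-(N : ℤ)) N
  have hF0 : (0 : Fin n → ℤ) ∈ F := by simp [F]
  have key : ∀ y ∈ Metric.ball x 1, ∀ a : Fin n → ℤ, a ∉ F →
      dotp (fun i => (a i : ℝ)) y - g a ≤ dotp (fun i => ((0 : Fin n → ℤ) i : ℝ)) y - g 0 := by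
    intro y hy a ha
    have h0 : dotp (fun i => ((0 : Fin n → ℤ) i : ℝ)) y = 0 := by simp [dotp]
    rw [h0]
    simp only [F, Fintype.mem_piFinset, Finset.mem_Icc, not_forall] at ha
    obtain ⟨i, hi⟩ := ha
    have hball : ∀ c : ℝ, |c| ≤ 1 → y + Pi.single i c ∈ Metric.closedBall x 2 := by
      intro c hcc
      rw [Metric.mem_closedBall]
      have h1 : dist (y + Pi.single i c) y ≤ 1 := by
        rw [dist_eq_norm, add_sub_cancel_left]
        rw [pi_norm_le_iff_of_nonneg zero_le_one]
        intro j
        by_cases hj : j = i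
        · subst hj; simpa using hcc
        · simp [hj]
      have h2 := dist_triangle (y + Pi.single i c) y x
      have h3 := Metric.mem_ball.1 hy
      linarith
    have e1 := (hg a _).trans (hH' _ (hball 1 (by simp)))
    have e2 := (hg a _).trans (hH' _ (hball (-1) (by simp)))
    rw [dotp_add_right, dotp_single] at e1 e2
    have : (a i < -(N:ℤ)) ∨ (N : ℤ) < a i := by
      by_contra hcon
      push Not at hcon
      exact hi hcon
    rcases this with hlt | hlt
    · have : (a i : ℝ) < -(N : ℝ) := by exact_mod_cast hlt
      linarith
    · have : (N : ℝ) < (a i : ℝ) := by exact_mod_cast hlt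
      linarith
  have hcard : F.card = (F.card - 1) + 1 := by
    have : 0 < F.card := Finset.card_pos.2 ⟨0, hF0⟩
    omega
  let E := F.equivFinOfCardEq hcard
  refine ⟨Metric.ball x 1, Metric.ball_mem_nhds x one_pos, F.card - 1,
    fun i => (E.symm i).1, fun i => - g (E.symm i).1, ?_⟩
  intro y hy
  have hmem : ∀ a ∈ F, dotp (fun i => (a i : ℝ)) y - g a ≤
      Finset.univ.sup' Finset.univ_nonempty
      (fun i => dotp (fun j => (((E.symm i).1 : Fin n → ℤ) j : ℝ)) y + - g (E.symm i).1) := by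
    intro a ha
    have := Finset.le_sup' (fun i => dotp (fun j => (((E.symm i).1 : Fin n → ℤ) j : ℝ)) y
      + - g (E.symm i).1) (Finset.mem_univ (E ⟨a, ha⟩))
    simp only [Equiv.symm_apply_apply] at this
    rw [sub_eq_add_neg]
    exact this
  apply le_antisymm
  · refine ciSup_le fun a => ?_
    by_cases ha : a ∈ F
    · exact hmem a ha
    · exact (key y hy a ha).trans (hmem 0 hF0)
  · refine Finset.sup'_le _ _ fun i _ => ?_
    rw [← sub_eq_add_neg]
    exact le_ciSup (bdd y) (E.symm i).1

lemma IsSymmBilin.add_right {Q : (Fin n → ℝ) → (Fin n → ℝ) → ℝ} (hQ : IsSymmBilin Q)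
    (x y z : Fin n → ℝ) : Q x (y + z) = Q x y + Q x z := (hQ.1 x).map_add y z

lemma IsSymmBilin.sub_right {Q : (Fin n → ℝ) → (Fin n → ℝ) → ℝ} (hQ : IsSymmBilin Q)
    (x y z : Fin n → ℝ) : Q x (y - z) = Q x y - Q x z := (hQ.1 x).map_sub y z

lemma IsSymmBilin.add_left {Q : (Fin n → ℝ) → (Fin n → ℝ) → ℝ} (hQ : IsSymmBilin Q)
    (x y z : Fin n → ℝ) : Q (x + y) z = Q x z + Q y z := by
  rw [hQ.2, hQ.add_right, hQ.2 x, hQ.2 y]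

lemma IsSymmBilin.sub_left {Q : (Fin n → ℝ) → (Fin n → ℝ) → ℝ} (hQ : IsSymmBilin Q)
    (x y z : Fin n → ℝ) : Q (x - y) z = Q x z - Q y z := by
  rw [hQ.2, hQ.sub_right, hQ.2 x, hQ.2 y]

lemma IsSymmBilin.expand {Q : (Fin n → ℝ) → (Fin n → ℝ) → ℝ} (hQ : IsSymmBilin Q)
    (x y : Fin n → ℝ) : Q x y = ∑ j, y j * Q x (Pi.single j 1) := by
  have h := pi_eq_sum_univ' y
  have h2 : (hQ.1 x).mk' (Q x) y = (hQ.1 x).mk' (Q x) (∑ i, y i • fun j => if i = j then 1 else 0) :=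
    congrArg _ (by simpa [eq_comm] using pi_eq_sum_univ y)
  rw [map_sum] at h2
  simp only [map_smul, IsLinearMap.mk'_apply, smul_eq_mul] at h2
  rw [h2]
  refine Finset.sum_congr rfl fun i _ => ?_
  congr 2
  funext j
  simp [Pi.single_apply, eq_comm]

lemma IsSymmBilin.continuous_diag {Q : (Fin n → ℝ) → (Fin n → ℝ) → ℝ} (hQ : IsSymmBilin Q) :
    Continuous fun y => Q y y := by
  have : (fun y => Q y y) = fun y => ∑ j, y j * (∑ i, y i * Q (Pi.single j 1) (Pi.single i 1)) := by
    funext y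
    rw [hQ.expand y y]
    refine Finset.sum_congr rfl fun j _ => ?_
    rw [hQ.2 y, hQ.expand _ y]
  rw [this]
  fun_prop

lemma IsSymmBilin.continuous_left {Q : (Fin n → ℝ) → (Fin n → ℝ) → ℝ} (hQ : IsSymmBilin Q)
    (r : Fin n → ℝ) : Continuous fun y => Q y r := by
  have : (fun y => Q y r) = fun y => ∑ j, y j * Q r (Pi.single j 1) := by
    funext y
    rw [hQ.2, hQ.expand r y]
  rw [this]
  fun_prop

lemma IsLattice.zero_mem {Λ : Set (Fin n → ℝ)} (hΛ : IsLattice Λ) : (0 : Fin n → ℝ) ∈ Λ := by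
  obtain ⟨e, rfl⟩ := hΛ
  exact ⟨0, by simp⟩

lemma IsLattice.add_mem {Λ : Set (Fin n → ℝ)} (hΛ : IsLattice Λ) {x y : Fin n → ℝ}
    (hx : x ∈ Λ) (hy : y ∈ Λ) : x + y ∈ Λ := by
  obtain ⟨e, rfl⟩ := hΛ
  obtain ⟨c, rfl⟩ := hx
  obtain ⟨d, rfl⟩ := hy
  exact ⟨c + d, by simp [add_smul, Finset.sum_add_distrib]⟩

lemma periodic_bddBelow {Λ : Set (Fin n → ℝ)} (hΛ : IsLattice Λ) (P : (Fin n → ℝ) → ℝ)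
    (hP : Continuous P) (hper : ∀ l ∈ Λ, ∀ x, P (x + l) = P x) : ∃ C, ∀ x, C ≤ P x := by
  obtain ⟨e, rfl⟩ := hΛ
  let f : (Fin n → ℝ) → (Fin n → ℝ) := fun c => ∑ i, c i • e i
  have hf : Continuous f := by
    refine continuous_finsetSum _ fun i _ => ?_
    exact (continuous_apply i).smul continuous_const
  have hK : IsCompact (Set.Icc (0 : Fin n → ℝ) 1) := isCompact_Icc
  obtain ⟨C, hC⟩ := hK.bddBelow_image (hP.comp hf).continuousOn
  refine ⟨C, fun x => ?_⟩
  have hx : f (fun i => Int.fract (e.repr x i)) + ∑ i, ((⌊e.repr x i⌋ : ℤ) : ℝ) • e i = x := by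
    simp only [f, ← Finset.sum_add_distrib, ← add_smul, Int.fract_add_floor]
    exact e.sum_repr x
  rw [← hx, hper _ ⟨fun i => ⌊e.repr x i⌋, rfl⟩]
  exact hC ⟨_, ⟨fun i => Int.fract_nonneg _, fun i => (Int.fract_lt_one _).le⟩, rfl⟩

/-- the affine function attached to an integral vector -/
def term0 (Q : (Fin n → ℝ) → (Fin n → ℝ) → ℝ) (r : Fin n → ℝ) (v : (Fin n → ℝ) → (Fin n → ℝ))
    (a : Fin n → ℤ) (y : Fin n → ℝ) : ℝ :=
  dotp (fun i => (a i : ℝ)) y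
    - (1/2) * Q (v (fun i => (a i : ℝ)) - r) (v (fun i => (a i : ℝ)) - r)

/-- the quadratic part -/
def hFn (Q : (Fin n → ℝ) → (Fin n → ℝ) → ℝ) (r y : Fin n → ℝ) : ℝ :=
  (1/2) * Q y y + Q y r

lemma term0_eq {Q : (Fin n → ℝ) → (Fin n → ℝ) → ℝ} (hQ : IsSymmBilin Q) (r : Fin n → ℝ)
    (v : (Fin n → ℝ) → (Fin n → ℝ)) (hv : ∀ a x, Q (v a) x = dotp a x)
    (a : Fin n → ℤ) (y : Fin n → ℝ) :
    term0 Q r v a y = hFn Q r y - (1/2) * Q (v (fun i => (a i : ℝ)) - r - y)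
      (v (fun i => (a i : ℝ)) - r - y) := by
  unfold term0 hFn
  rw [← hv]
  generalize v (fun i => (a i : ℝ)) = w
  simp only [hQ.sub_left, hQ.sub_right]
  rw [hQ.2 y w, hQ.2 r w, hQ.2 r y]
  ring

lemma term0_le {Q : (Fin n → ℝ) → (Fin n → ℝ) → ℝ} (hQ : IsSymmBilin Q)
    (hpos : ∀ x : Fin n → ℝ, x ≠ 0 → 0 < Q x x) (r : Fin n → ℝ)
    (v : (Fin n → ℝ) → (Fin n → ℝ)) (hv : ∀ a x, Q (v a) x = dotp a x)
    (a : Fin n → ℤ) (y : Fin n → ℝ) : term0 Q r v a y ≤ hFn Q r y := by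
  rw [term0_eq hQ r v hv]
  have : ∀ z, 0 ≤ Q z z := by
    intro z
    by_cases hz : z = 0
    · subst hz
      exact ((hQ.1 0).map_zero).ge
    · exact (hpos z hz).le
  have := this (v (fun i => (a i : ℝ)) - r - y)
  linarith

lemma v_shift {Q : (Fin n → ℝ) → (Fin n → ℝ) → ℝ} (hQ : IsSymmBilin Q)
    (hpos : ∀ x : Fin n → ℝ, x ≠ 0 → 0 < Q x x)
    (v : (Fin n → ℝ) → (Fin n → ℝ)) (hv : ∀ a x, Q (v a) x = dotp a x)
    (a b l : Fin n → ℝ) (h : ∀ x, dotp a x = dotp b x + Q l x) : v a = l + v b := by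
  by_contra hne
  have hne' : v a - (l + v b) ≠ 0 := sub_ne_zero.2 hne
  have h1 := hpos _ hne'
  rw [hQ.sub_left, hQ.add_left, hv, hv, h] at h1
  linarith

lemma term0_shift {Q : (Fin n → ℝ) → (Fin n → ℝ) → ℝ} (hQ : IsSymmBilin Q)
    (hpos : ∀ x : Fin n → ℝ, x ≠ 0 → 0 < Q x x) (r : Fin n → ℝ)
    (v : (Fin n → ℝ) → (Fin n → ℝ)) (hv : ∀ a x, Q (v a) x = dotp a x)
    (a b : Fin n → ℤ) (l : Fin n → ℝ)
    (h : ∀ x, dotp (fun i => (a i : ℝ)) x = dotp (fun i => (b i : ℝ)) x + Q l x)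
    (y : Fin n → ℝ) :
    term0 Q r v a (y + l) - hFn Q r (y + l) = term0 Q r v b y - hFn Q r y := by
  rw [term0_eq hQ r v hv, term0_eq hQ r v hv, v_shift hQ hpos v hv _ _ l h]
  have : l + v (fun i => (b i : ℝ)) - r - (y + l) = v (fun i => (b i : ℝ)) - r - y := by abel
  rw [this]
  ring

lemma hFn_shift {Q : (Fin n → ℝ) → (Fin n → ℝ) → ℝ} (hQ : IsSymmBilin Q) (r y l : Fin n → ℝ) :
    hFn Q r (y + l) = hFn Q r y + Q l y + (1/2) * Q l l + Q l r := by
  unfold hFn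
  simp only [hQ.add_left, hQ.add_right]
  rw [hQ.2 y l]
  ring

lemma exists_int {Q : (Fin n → ℝ) → (Fin n → ℝ) → ℝ} (hQ : IsSymmBilin Q)
    {Λ : Set (Fin n → ℝ)} (hint : IntegralWrt Q Λ) (l : Fin n → ℝ) (hl : l ∈ Λ) :
    ∃ k : Fin n → ℤ, ∀ x, dotp (fun i => (k i : ℝ)) x = Q l x := by
  choose k hk using fun i : Fin n => hint l hl (Pi.single i 1)
  refine ⟨k, fun x => ?_⟩
  rw [hQ.expand l x]
  refine Finset.sum_congr rfl fun i _ => ?_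
  show (k i : ℝ) * x i = _
  rw [← hk i, mul_comm]
  congr 2
  funext j
  by_cases hj : j = i
  · subst hj; simp
  · simp [hj]

end helpers

section main

variable {n : ℕ} (Λ : Set (Fin n → ℝ)) (hΛ : IsLattice Λ)
    (Q : (Fin n → ℝ) → (Fin n → ℝ) → ℝ) (hQ : IsSymmBilin Q)
    (hpos : ∀ x : Fin n → ℝ, x ≠ 0 → 0 < Q x x) (hint : IntegralWrt Q Λ)
    (r : Fin n → ℝ) (v : (Fin n → ℝ) → (Fin n → ℝ))
    (hv : ∀ a x, Q (v a) x = dotp a x)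

lemma genOf_isLUB (hΛ : IsLattice Λ) (hQ : IsSymmBilin Q)
    (hpos : ∀ x : Fin n → ℝ, x ≠ 0 → 0 < Q x x) (hint : IntegralWrt Q Λ)
    (hv : ∀ a x, Q (v a) x = dotp a x) (b : Fin n → ℤ) (y : Fin n → ℝ) :
    IsLUB {t | ∃ a : Fin n → ℤ, (∃ l ∈ Λ, ∀ x, dotp (fun i => (a i : ℝ)) x
      = dotp (fun i => (b i : ℝ)) x + Q l x) ∧ t = term0 Q r v a y} (thetaGenOf Λ Q r v b y) := by
  have hset : {t | ∃ l ∈ Λ, t = dotp (fun i => (b i : ℝ)) y + Q l y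
      - (1/2) * Q (l + v (fun i => (b i : ℝ)) - r) (l + v (fun i => (b i : ℝ)) - r)} =
      {t | ∃ a : Fin n → ℤ, (∃ l ∈ Λ, ∀ x, dotp (fun i => (a i : ℝ)) x
      = dotp (fun i => (b i : ℝ)) x + Q l x) ∧ t = term0 Q r v a y} := by
    ext t
    constructor
    · rintro ⟨l, hl, rfl⟩
      obtain ⟨k, hk⟩ := exists_int hQ hint l hl
      have hh : ∀ x, dotp (fun i => (((b + k : Fin n → ℤ) i : ℤ) : ℝ)) x
          = dotp (fun i => (b i : ℝ)) x + Q l x := by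
        intro x
        rw [← hk, ← dotp_add_left]
        congr 1
        funext i
        simp
      refine ⟨b + k, ⟨l, hl, hh⟩, ?_⟩
      unfold term0
      rw [v_shift hQ hpos v hv _ _ l hh, hh]
    · rintro ⟨a, ⟨l, hl, hh⟩, rfl⟩
      refine ⟨l, hl, ?_⟩
      unfold term0
      rw [v_shift hQ hpos v hv _ _ l hh, hh]
  unfold thetaGenOf ThetaGen
  rw [hset]
  refine isLUB_csSup ⟨_, b, ⟨0, hΛ.zero_mem, fun x => ?_⟩, rfl⟩ ⟨hFn Q r y, ?_⟩
  · rw [hQ.2, (hQ.1 x).map_zero, add_zero]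
  · rintro _ ⟨a, _, rfl⟩
    exact term0_le hQ hpos r v hv a y

lemma phi_isGLB (hΛ : IsLattice Λ) (hQ : IsSymmBilin Q)
    (hpos : ∀ x : Fin n → ℝ, x ≠ 0 → 0 < Q x x) (hint : IntegralWrt Q Λ)
    (hv : ∀ a x, Q (v a) x = dotp a x) (b : Fin n → ℤ) (Θ : (Fin n → ℝ) → ℝ)
    (hΘ : IsThetaFn Λ Q (fun x => Q x r) Θ) :
    IsGLB {u | ∃ y, u = Θ y - thetaGenOf Λ Q r v b y} (phiB Λ Q r v b Θ) := by
  obtain ⟨hconv, hreg, hqp⟩ := hΘ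
  have hcont : Continuous Θ := by
    rw [← continuousOn_univ]
    exact hconv.continuousOn isOpen_univ
  have hh : Continuous (hFn Q r) :=
    (continuous_const.mul hQ.continuous_diag).add (hQ.continuous_left r)
  obtain ⟨C, hC⟩ := periodic_bddBelow hΛ (fun x => Θ x - hFn Q r x) (hcont.sub hh) (by
    intro l hl x
    show Θ (x + l) - hFn Q r (x + l) = Θ x - hFn Q r x
    rw [hqp l hl, hFn_shift hQ]
    ring)
  refine isGLB_csInf ⟨_, 0, rfl⟩ ⟨C, ?_⟩
  rintro _ ⟨y, rfl⟩
  have h1 := hC y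
  have h2 : thetaGenOf Λ Q r v b y ≤ hFn Q r y := by
    refine (genOf_isLUB Λ Q r v hΛ hQ hpos hint hv b y).2 ?_
    rintro _ ⟨a, _, rfl⟩
    exact term0_le hQ hpos r v hv a y
  linarith

lemma phi_le (hΛ : IsLattice Λ) (hQ : IsSymmBilin Q)
    (hpos : ∀ x : Fin n → ℝ, x ≠ 0 → 0 < Q x x) (hint : IntegralWrt Q Λ)
    (hv : ∀ a x, Q (v a) x = dotp a x) (b : Fin n → ℤ) (Θ : (Fin n → ℝ) → ℝ)
    (hΘ : IsThetaFn Λ Q (fun x => Q x r) Θ) (a : Fin n → ℤ)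
    (ha : ∃ l ∈ Λ, ∀ x, dotp (fun i => (a i : ℝ)) x = dotp (fun i => (b i : ℝ)) x + Q l x)
    (y : Fin n → ℝ) : term0 Q r v a y + phiB Λ Q r v b Θ ≤ Θ y := by
  have h1 := (phi_isGLB Λ Q r v hΛ hQ hpos hint hv b Θ hΘ).1 ⟨y, rfl⟩
  have h2 := (genOf_isLUB Λ Q r v hΛ hQ hpos hint hv b y).1 ⟨a, ha, rfl⟩
  linarith

lemma phi_approx (hΛ : IsLattice Λ) (hQ : IsSymmBilin Q)
    (hpos : ∀ x : Fin n → ℝ, x ≠ 0 → 0 < Q x x) (hint : IntegralWrt Q Λ)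
    (hv : ∀ a x, Q (v a) x = dotp a x) (b : Fin n → ℤ) (Θ : (Fin n → ℝ) → ℝ)
    (hΘ : IsThetaFn Λ Q (fun x => Q x r) Θ) (ε : ℝ) (hε : 0 < ε) :
    ∃ y, Θ y ≤ term0 Q r v b y + phiB Λ Q r v b Θ + ε := by
  obtain ⟨_, ⟨y, rfl⟩, -, hy⟩ := (phi_isGLB Λ Q r v hΛ hQ hpos hint hv b Θ hΘ).exists_between
    (show phiB Λ Q r v b Θ < phiB Λ Q r v b Θ + ε / 2 by linarith)
  obtain ⟨_, ⟨a, ⟨l, hl, ha⟩, rfl⟩, hy2, -⟩ :=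
    (genOf_isLUB Λ Q r v hΛ hQ hpos hint hv b y).exists_between
    (show thetaGenOf Λ Q r v b y - ε / 2 < thetaGenOf Λ Q r v b y by linarith)
  refine ⟨y - l, ?_⟩
  have h1 := term0_shift hQ hpos r v hv a b l ha (y - l)
  have h2 := hΘ.2.2 l hl (y - l)
  have h3 := hFn_shift hQ r (y - l) l
  simp only [sub_add_cancel] at h1 h2 h3
  linarith

end main

theorem stmt11 {n : ℕ} (Λ : Set (Fin n → ℝ)) (hΛ : IsLattice Λ)
    (Q : (Fin n → ℝ) → (Fin n → ℝ) → ℝ) (hQ : IsSymmBilin Q)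
    (hpos : ∀ x : Fin n → ℝ, x ≠ 0 → 0 < Q x x) (hint : IntegralWrt Q Λ)
    (r : Fin n → ℝ) (v : (Fin n → ℝ) → (Fin n → ℝ))
    (hv : ∀ a x, Q (v a) x = dotp a x)
    (B : Finset (Fin n → ℤ))
    (hB : ∀ m : Fin n → ℤ, ∃! b, b ∈ B ∧
      InQLat Λ Q (fun i => (m i : ℝ) - (b i : ℝ))) :
    Convex ℝ (thetaCoordSet Λ Q r v B) := by
  -- restate the representatives
  have hB' : ∀ m : Fin n → ℤ, ∃ b : {b // b ∈ B},
      (∃ l ∈ Λ, ∀ x, dotp (fun i => (m i : ℝ)) x = dotp (fun i => (b.1 i : ℝ)) x + Q l x) ∧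
      ∀ b' : {b // b ∈ B}, (∃ l ∈ Λ, ∀ x, dotp (fun i => (m i : ℝ)) x
        = dotp (fun i => (b'.1 i : ℝ)) x + Q l x) → b' = b := by
    intro m
    have hsub : ∀ (b : Fin n → ℤ) x, dotp (fun i => (m i : ℝ) - (b i : ℝ)) x
        = dotp (fun i => (m i : ℝ)) x - dotp (fun i => (b i : ℝ)) x := by
      intro b x
      rw [← dotp_sub_left]; rfl
    obtain ⟨b, ⟨hb, l, hl, hbl⟩, hu⟩ := hB m
    refine ⟨⟨b, hb⟩, ⟨l, hl, fun x => ?_⟩, ?_⟩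
    · have := hbl x
      rw [hsub] at this
      simp only
      linarith
    · rintro ⟨b', hb'⟩ ⟨l', hl', h'⟩
      refine Subtype.ext (hu b' ⟨hb', l', hl', fun x => ?_⟩)
      rw [hsub, h' x]
      simp
  choose β hβ hβu using hB'
  have hβb : ∀ (b : {b // b ∈ B}) (a : Fin n → ℤ), (∃ l ∈ Λ, ∀ x, dotp (fun i => (a i : ℝ)) x
        = dotp (fun i => (b.1 i : ℝ)) x + Q l x) → β a = b := fun b a h => (hβu a b h).symm
  have hself : ∀ b : {b // b ∈ B}, β b.1 = b := fun b => hβb b b.1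
    ⟨0, hΛ.zero_mem, fun x => by rw [hQ.2, (hQ.1 x).map_zero, add_zero]⟩
  have hh : Continuous (hFn Q r) :=
    (continuous_const.mul hQ.continuous_diag).add (hQ.continuous_left r)
  rintro t₁ ⟨Θ₁, hΘ₁, ht₁⟩ t₂ ⟨Θ₂, hΘ₂, ht₂⟩ s₁ s₂ hs₁ hs₂ hs
  set t : {b // b ∈ B} → ℝ := s₁ • t₁ + s₂ • t₂ with ht
  let g : (Fin n → ℤ) → ℝ := fun a => (1/2) * Q (v (fun i => (a i : ℝ)) - r)
    (v (fun i => (a i : ℝ)) - r) - t (β a)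
  have hterm : ∀ a y, dotp (fun i => ((a : Fin n → ℤ) i : ℝ)) y - g a
      = term0 Q r v a y + t (β a) := by
    intro a y
    simp only [g, term0]
    ring
  obtain ⟨T, hT⟩ := (Set.finite_range t).bddAbove
  have hg : ∀ a y, dotp (fun i => ((a : Fin n → ℤ) i : ℝ)) y - g a ≤ hFn Q r y + T := by
    intro a y
    rw [hterm]
    exact add_le_add (term0_le hQ hpos r v hv a y) (hT ⟨_, rfl⟩)
  have hle : ∀ a y, term0 Q r v a y + t (β a) ≤ supFn g y := by
    intro a y
    rw [← hterm]
    refine le_ciSup (f := fun a : Fin n → ℤ => dotp (fun i => (a i : ℝ)) y - g a)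
      ⟨hFn Q r y + T, ?_⟩ a
    rintro _ ⟨a, rfl⟩
    exact hg a y
  refine ⟨supFn g, ⟨supFn_convex g _ hg, supFn_regular g _ (hh.add continuous_const) hg, ?_⟩, ?_⟩
  · -- quasi-periodicity
    intro l hl x
    obtain ⟨k, hk⟩ := exists_int hQ hint l hl
    have hak : ∀ (a : Fin n → ℤ) x, dotp (fun i => (((a + k : Fin n → ℤ) i : ℤ) : ℝ)) x
          = dotp (fun i => (a i : ℝ)) x + Q l x := by
      intro a x
      rw [← hk, ← dotp_add_left]
      congr 1
      funext i
      simp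
    have hstep : ∀ a : Fin n → ℤ, term0 Q r v (a + k) (x + l) + t (β (a + k))
        = (term0 Q r v a x + t (β a)) + (hFn Q r (x + l) - hFn Q r x) := by
      intro a
      have h1 := term0_shift hQ hpos r v hv (a + k) a l (hak a) x
      have h2 : β (a + k) = β a := by
        apply hβb
        obtain ⟨l', hl', h'⟩ := hβ a
        refine ⟨l' + l, hΛ.add_mem hl' hl, fun x => ?_⟩
        rw [hak, h', hQ.add_left]
        ring
      rw [h2]
      linarith
    have hshift := hFn_shift hQ r x l
    apply le_antisymm
    · refine ciSup_le fun a => ?_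
      rw [hterm]
      have h1 := hstep (a - k)
      have h2 := hle (a - k) x
      rw [sub_add_cancel] at h1
      linarith
    · have : supFn g x ≤ supFn g (x + l) - (hFn Q r (x + l) - hFn Q r x) := by
        refine ciSup_le fun a => ?_
        rw [hterm]
        have h1 := hstep a
        have h2 := hle (a + k) (x + l)
        linarith
      linarith
  · intro b
    have hlow : ∀ u ∈ {u | ∃ y, u = supFn g y - thetaGenOf Λ Q r v b.1 y}, t b ≤ u := by
      rintro _ ⟨y, rfl⟩
      have : thetaGenOf Λ Q r v b.1 y ≤ supFn g y - t b := by
        refine (genOf_isLUB Λ Q r v hΛ hQ hpos hint hv b.1 y).2 ?_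
        rintro _ ⟨a, ha, rfl⟩
        have h1 := hle a y
        rw [hβb b a ha] at h1
        linarith
      linarith
    apply le_antisymm
    · exact le_csInf ⟨_, 0, rfl⟩ hlow
    · refine le_of_forall_pos_le_add fun ε hε => ?_
      obtain ⟨y₁, hy₁⟩ := phi_approx Λ Q r v hΛ hQ hpos hint hv b.1 Θ₁ hΘ₁ ε hε
      obtain ⟨y₂, hy₂⟩ := phi_approx Λ Q r v hΛ hQ hpos hint hv b.1 Θ₂ hΘ₂ ε hε
      rw [← ht₁ b] at hy₁
      rw [← ht₂ b] at hy₂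
      have haff : ∀ a, term0 Q r v a (s₁ • y₁ + s₂ • y₂)
          = s₁ * term0 Q r v a y₁ + s₂ * term0 Q r v a y₂ := by
        intro a
        unfold term0
        rw [dotp_add_right, dotp_smul_right, dotp_smul_right]
        obtain rfl : s₂ = 1 - s₁ := by linarith
        ring
      have htb : ∀ c, t c = s₁ * t₁ c + s₂ * t₂ c := fun c => by simp [ht]
      have hup : supFn g (s₁ • y₁ + s₂ • y₂) ≤ term0 Q r v b.1 (s₁ • y₁ + s₂ • y₂) + t b + ε := by
        refine ciSup_le fun a => ?_
        rw [hterm, haff, haff, htb, htb]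
        have e1 := (phi_le Λ Q r v hΛ hQ hpos hint hv (β a).1 Θ₁ hΘ₁ a (hβ a) y₁)
        have e2 := (phi_le Λ Q r v hΛ hQ hpos hint hv (β a).1 Θ₂ hΘ₂ a (hβ a) y₂)
        rw [← ht₁] at e1
        rw [← ht₂] at e2
        have f1 := mul_le_mul_of_nonneg_left (e1.trans hy₁) hs₁
        have f2 := mul_le_mul_of_nonneg_left (e2.trans hy₂) hs₂
        have f3 : ε = s₁ * ε + s₂ * ε := by rw [← add_mul, hs, one_mul]
        linarith
      have hgen : term0 Q r v b.1 (s₁ • y₁ + s₂ • y₂) ≤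
          thetaGenOf Λ Q r v b.1 (s₁ • y₁ + s₂ • y₂) := by
        refine (genOf_isLUB Λ Q r v hΛ hQ hpos hint hv b.1 _).1 ⟨b.1, ⟨0, hΛ.zero_mem, ?_⟩, rfl⟩
        intro x
        rw [hQ.2, (hQ.1 x).map_zero, add_zero]
      have : phiB Λ Q r v b.1 (supFn g) ≤ supFn g (s₁ • y₁ + s₂ • y₂)
          - thetaGenOf Λ Q r v b.1 (s₁ • y₁ + s₂ • y₂) := csInf_le ⟨t b, hlow⟩ ⟨_, rfl⟩
      linarith
end
end
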